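/- arXiv:2601.15208 — 8 statements merged into one kernel-verified Lean document; each statement's English description precedes it below -/
import Mathlib

section
/- Assume in addition that each g_i is continuous and Fréchet differentiable on H. Then for every μ > 0 the function φ_μ is Fréchet differentiable on H and its gradient is given by the envelope formula ∇φ_μ(x) = ∑_{i=1}^m λ^μ(x)_i ∇g_i(x) for every x ∈ H. -/
open scoped BigOperators
open Set Filter

/-- The regularized function `φ_μ(x) = max_{λ ∈ Q} ( ∑ i, λ_i g_i(x) - μ D(λ) )`. -/
noncomputable def phiMu {H : Type*} (m : ℕ) (g : Fin m → H → ℝ)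
    (Q : Set (EuclideanSpace ℝ (Fin m))) (D : EuclideanSpace ℝ (Fin m) → ℝ)
    (μ : ℝ) (x : H) : ℝ :=
  sSup ((fun l : EuclideanSpace ℝ (Fin m) => ∑ i, l i * g i x - μ * D l) '' Q)

theorem statement3 {H : Type*} [NormedAddCommGroup H] [InnerProductSpace ℝ H]
    [CompleteSpace H]
    (m : ℕ) (hm : 1 ≤ m)
    (g : Fin m → H → ℝ) (hg : ∀ i, ConvexOn ℝ Set.univ (g i))
    (hgcont : ∀ i, Continuous (g i)) (hgdiff : ∀ i, Differentiable ℝ (g i))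
    (Q : Set (EuclideanSpace ℝ (Fin m))) (hQne : Q.Nonempty) (hQcomp : IsCompact Q)
    (hQconv : Convex ℝ Q) (hQpos : ∀ l ∈ Q, ∀ i, 0 ≤ l i)
    (D : EuclideanSpace ℝ (Fin m) → ℝ) (hDcont : Continuous D)
    (hDnonneg : ∀ l ∈ Q, 0 ≤ D l)
    (σ : ℝ) (hσ : 0 < σ) (hDsc : StrongConvexOn Q σ D)
    (hDinf : IsGLB (D '' Q) 0)
    (C : ℝ) (hC : IsLUB (D '' Q) C)
    -- `lam μ x` is the unique maximizer over `Q` of `λ ↦ ∑ i, λ i * g i x - μ * D λ`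
    (lam : ℝ → H → EuclideanSpace ℝ (Fin m))
    (hlam : ∀ μ > (0 : ℝ), ∀ x : H, lam μ x ∈ Q ∧
      ∀ l ∈ Q, ∑ i, l i * g i x - μ * D l ≤ ∑ i, (lam μ x) i * g i x - μ * D (lam μ x))
    (hlam_uniq : ∀ μ > (0 : ℝ), ∀ x : H, ∀ l ∈ Q,
      (∀ l' ∈ Q, ∑ i, l' i * g i x - μ * D l' ≤ ∑ i, l i * g i x - μ * D l) →
      l = lam μ x) :
    ∀ μ > (0 : ℝ), ∀ x : H,
      HasGradientAt (phiMu m g Q D μ) (∑ i, (lam μ x) i • gradient (g i) x) x := by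
  intro μ hμ x
  have hphi : ∀ y, phiMu m g Q D μ y
      = ∑ i, (lam μ y) i * g i y - μ * D (lam μ y) := by
    intro y
    apply IsGreatest.csSup_eq
    refine ⟨⟨lam μ y, (hlam μ hμ y).1, rfl⟩, ?_⟩
    rintro _ ⟨l, hl, rfl⟩
    exact (hlam μ hμ y).2 l hl
  let G : H → EuclideanSpace ℝ (Fin m) := fun y => WithLp.toLp 2 (fun i => g i y)
  have hin : ∀ (l : EuclideanSpace ℝ (Fin m)) y, ∑ i, l i * g i y = inner ℝ l (G y) := by
    intro l y
    simp [G, PiLp.inner_apply, mul_comm]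
  have hGd : Differentiable ℝ G := by
    rw [differentiable_euclidean]
    exact hgdiff
  -- quadratic growth
  have hgrow : ∀ y, ∀ b ∈ Q, μ * σ / 4 * ‖lam μ y - b‖ ^ 2 ≤
      (inner ℝ (lam μ y) (G y) - μ * D (lam μ y)) - (inner ℝ b (G y) - μ * D b) := by
    intro y b hb
    obtain ⟨ha, hmax⟩ := hlam μ hμ y
    have hmid : (1/2 : ℝ) • lam μ y + (1/2 : ℝ) • b ∈ Q :=
      hQconv ha hb (by norm_num) (by norm_num) (by norm_num)
    have h1 := hDsc.2 ha hb (show (0:ℝ) ≤ 1/2 by norm_num) (show (0:ℝ) ≤ 1/2 by norm_num) (by norm_num)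
    have h2 := hmax _ hmid
    rw [hin, hin, inner_add_left, real_inner_smul_left, real_inner_smul_left] at h2
    simp only [smul_eq_mul] at h1
    have h3 := mul_le_mul_of_nonneg_left h1 hμ.le
    nlinarith [h2, h3]
  have hlip : ∀ y, ‖lam μ y - lam μ x‖ ≤ 2 / (μ * σ) * ‖G y - G x‖ := by
    intro y
    have h1 := hgrow y _ (hlam μ hμ x).1
    have h2 := hgrow x _ (hlam μ hμ y).1
    rw [norm_sub_rev (lam μ x)] at h2
    have h3 := real_inner_le_norm (lam μ y - lam μ x) (G y - G x)
    rw [inner_sub_left, inner_sub_right, inner_sub_right] at h3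
    have hp : 0 < μ * σ := mul_pos hμ hσ
    rcases (norm_nonneg (lam μ y - lam μ x)).eq_or_lt with h0 | h0
    · rw [← h0]; positivity
    · rw [div_mul_eq_mul_div, le_div_iff₀ hp]
      refine le_of_mul_le_mul_left ?_ h0
      nlinarith
  have hrem : ∀ y, ‖phiMu m g Q D μ y - phiMu m g Q D μ x
      - inner ℝ (lam μ x) (G y - G x)‖ ≤ 2 / (μ * σ) * ‖‖G y - G x‖ ^ 2‖ := by
    intro y
    have h1 := (hlam μ hμ y).2 _ (hlam μ hμ x).1
    have h2 := (hlam μ hμ x).2 _ (hlam μ hμ y).1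
    have h3 := real_inner_le_norm (lam μ y - lam μ x) (G y - G x)
    have h4 := mul_le_mul_of_nonneg_right (hlip y) (norm_nonneg (G y - G x))
    rw [hphi, hphi]
    simp only [hin] at *
    rw [inner_sub_left, inner_sub_right, inner_sub_right] at h3
    rw [inner_sub_right, Real.norm_of_nonneg (by linarith), Real.norm_of_nonneg (by positivity)]
    nlinarith
  have hO : (fun y => ‖G y - G x‖ ^ 2) =o[nhds x] fun y => y - x := by
    have h1 : (fun y => G y - G x) =O[nhds x] fun y => y - x := (hGd x).isBigO_sub
    have h2 : (fun y => ‖G y - G x‖) =o[nhds x] fun _ => (1:ℝ) := by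
      rw [Asymptotics.isLittleO_one_iff]
      have := ((hGd.continuous.sub (continuous_const (y := G x))).norm).tendsto x
      simpa using this
    have h3 := h2.mul_isBigO h1.norm_norm
    simp only [one_mul] at h3
    simpa [pow_two] using h3.norm_right
  have hO2 : (fun y => phiMu m g Q D μ y - phiMu m g Q D μ x
      - inner ℝ (lam μ x) (G y - G x)) =o[nhds x] fun y => y - x :=
    (Asymptotics.IsBigO.of_bound _ (Eventually.of_forall hrem)).trans_isLittleO hO
  have hL : HasFDerivAt (fun y => ∑ i, (lam μ x) i * g i y)
      (∑ i, (lam μ x) i • fderiv ℝ (g i) x) x :=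
    HasFDerivAt.fun_sum fun i _ => (hgdiff i x).hasFDerivAt.const_mul _
  rw [hasGradientAt_iff_hasFDerivAt]
  have he : (InnerProductSpace.toDual ℝ H) (∑ i, (lam μ x) i • gradient (g i) x)
      = ∑ i, (lam μ x) i • fderiv ℝ (g i) x := by
    simp [map_sum, gradient]
  rw [he]
  have h5 := hO2.add hL.isLittleO
  refine HasFDerivAt.of_isLittleO (h5.congr_left ?_)
  intro y
  rw [hin, hin, inner_sub_right]
  ring
end

section
/- For every fixed x ∈ H, the function μ ↦ φ_μ(x) is differentiable on (0,∞), with derivative (d/dμ) φ_μ(x) = (1/μ)( φ_μ(x) − ∑_{i=1}^m λ^μ(x)_i g_i(x) ) = −D(λ^μ(x)) ≤ 0; in particular μ ↦ φ_μ(x) is nonincreasing. -/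
open scoped BigOperators
open Set Filter

theorem statement4 {H : Type*} [NormedAddCommGroup H] [InnerProductSpace ℝ H]
    [CompleteSpace H]
    (m : ℕ) (hm : 1 ≤ m)
    (g : Fin m → H → ℝ) (hg : ∀ i, ConvexOn ℝ Set.univ (g i))
    (Q : Set (EuclideanSpace ℝ (Fin m))) (hQne : Q.Nonempty) (hQcomp : IsCompact Q)
    (hQconv : Convex ℝ Q) (hQpos : ∀ l ∈ Q, ∀ i, 0 ≤ l i)
    (D : EuclideanSpace ℝ (Fin m) → ℝ) (hDcont : Continuous D)
    (hDnonneg : ∀ l ∈ Q, 0 ≤ D l)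
    (σ : ℝ) (hσ : 0 < σ) (hDsc : StrongConvexOn Q σ D)
    (hDinf : IsGLB (D '' Q) 0)
    (C : ℝ) (hC : IsLUB (D '' Q) C)
    -- `lam μ x` is the unique maximizer over `Q` of `λ ↦ ∑ i, λ i * g i x - μ * D λ`
    (lam : ℝ → H → EuclideanSpace ℝ (Fin m))
    (hlam : ∀ μ > (0 : ℝ), ∀ x : H, lam μ x ∈ Q ∧
      ∀ l ∈ Q, ∑ i, l i * g i x - μ * D l ≤ ∑ i, (lam μ x) i * g i x - μ * D (lam μ x))
    (hlam_uniq : ∀ μ > (0 : ℝ), ∀ x : H, ∀ l ∈ Q,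
      (∀ l' ∈ Q, ∑ i, l' i * g i x - μ * D l' ≤ ∑ i, l i * g i x - μ * D l) →
      l = lam μ x)
    (x : H) :
    (∀ μ > (0 : ℝ),
      HasDerivAt (fun ν => phiMu m g Q D ν x) (-(D (lam μ x))) μ ∧
      -(D (lam μ x)) =
        (1 / μ) * (phiMu m g Q D μ x - ∑ i, (lam μ x) i * g i x) ∧
      -(D (lam μ x)) ≤ 0) ∧
    AntitoneOn (fun μ => phiMu m g Q D μ x) (Set.Ioi 0) := by
  classical
  obtain ⟨S, hSdef⟩ : ∃ S : EuclideanSpace ℝ (Fin m) → ℝ, S = fun l => ∑ i, l i * g i x := ⟨_, rfl⟩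
  have hSc : Continuous S := by rw [hSdef]; fun_prop
  have hS : ∀ l : EuclideanSpace ℝ (Fin m), ∑ i, l i * g i x = S l := fun l => by rw [hSdef]
  obtain ⟨L, hL⟩ : ∃ L : ℝ → EuclideanSpace ℝ (Fin m), ∀ μ, L μ = lam μ x := ⟨_, fun _ => rfl⟩
  have hLQ : ∀ μ > 0, L μ ∈ Q := fun μ hμ => hL μ ▸ (hlam μ hμ x).1
  have hmax : ∀ μ > 0, ∀ l ∈ Q, S l - μ * D l ≤ S (L μ) - μ * D (L μ) := by
    intro μ hμ l hl
    have := (hlam μ hμ x).2 l hl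
    rwa [hS, hS, ← hL] at this
  have huniq : ∀ μ > 0, ∀ l ∈ Q, (∀ l' ∈ Q, S l' - μ * D l' ≤ S l - μ * D l) → l = L μ := by
    intro μ hμ l hl h
    rw [hL]
    exact hlam_uniq μ hμ x l hl (by simpa only [hS] using h)
  have hphi : ∀ μ > 0, phiMu m g Q D μ x = S (L μ) - μ * D (L μ) := by
    intro μ hμ
    unfold phiMu
    simp only [hS]
    apply IsGreatest.csSup_eq
    refine ⟨⟨L μ, hLQ μ hμ, rfl⟩, ?_⟩
    rintro _ ⟨l, hl, rfl⟩
    exact hmax μ hμ l hl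
  have hDC : ∀ l ∈ Q, D l ≤ C := fun l hl => hC.1 ⟨l, hl, rfl⟩
  have hcont : ∀ μ > 0, Tendsto L (nhds μ) (nhds (L μ)) := by
    intro μ hμ
    have hG : Tendsto (fun ν => S (L ν) - μ * D (L ν)) (nhds μ)
        (nhds (S (L μ) - μ * D (L μ))) := by
      have h0 : Tendsto (fun ν : ℝ => (S (L μ) - μ * D (L μ)) - |ν - μ| * C) (nhds μ)
          (nhds (S (L μ) - μ * D (L μ))) := by
        have : Continuous (fun ν : ℝ => (S (L μ) - μ * D (L μ)) - |ν - μ| * C) := by fun_prop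
        simpa using this.tendsto μ
      refine tendsto_of_tendsto_of_tendsto_of_le_of_le' h0 tendsto_const_nhds ?_ ?_
      · filter_upwards [lt_mem_nhds hμ] with ν hν
        have h1 := hmax ν hν (L μ) (hLQ μ hμ)
        have a1 := hDC _ (hLQ μ hμ)
        have a2 := hDC _ (hLQ ν hν)
        have b1 := hDnonneg _ (hLQ μ hμ)
        have b2 := hDnonneg _ (hLQ ν hν)
        have h2 : |(ν - μ) * (D (L ν) - D (L μ))| ≤ |ν - μ| * C := by
          rw [abs_mul]
          apply mul_le_mul_of_nonneg_left _ (abs_nonneg _)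
          rw [abs_le]; constructor <;> linarith
        have h3 := (abs_le.1 h2).1
        nlinarith
      · filter_upwards [lt_mem_nhds hμ] with ν hν
        exact hmax μ hμ _ (hLQ ν hν)
    refine hQcomp.tendsto_nhds_of_unique_mapClusterPt
      (by filter_upwards [lt_mem_nhds hμ] with ν hν using hLQ ν hν) ?_
    intro l hl hcl
    have hGc : Continuous (fun l => S l - μ * D l) := by fun_prop
    have h1 : MapClusterPt (S l - μ * D l) (nhds μ) (fun ν => S (L ν) - μ * D (L ν)) :=
      MapClusterPt.continuousAt_comp (f := fun l => S l - μ * D l) hGc.continuousAt hcl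
    have h2 : S l - μ * D l = S (L μ) - μ * D (L μ) := by
      have : ClusterPt (S l - μ * D l) (nhds (S (L μ) - μ * D (L μ))) := ClusterPt.mono h1 hG
      have : (nhds (S l - μ * D l) ⊓ nhds (S (L μ) - μ * D (L μ))).NeBot := this
      exact eq_of_nhds_neBot this
    exact huniq μ hμ l hl (fun l' hl' => h2 ▸ hmax μ hμ l' hl')
  refine ⟨fun μ hμ => ⟨?_, ?_, ?_⟩, ?_⟩
  · rw [← hL, hasDerivAt_iff_isLittleO, Asymptotics.isLittleO_iff]
    intro c hc
    have hD : Tendsto (fun ν => D (L ν)) (nhds μ) (nhds (D (L μ))) :=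
      (hDcont.tendsto _).comp (hcont μ hμ)
    filter_upwards [lt_mem_nhds hμ, Metric.tendsto_nhds.1 hD c hc] with ν hν hd
    rw [hphi ν hν, hphi μ hμ, smul_eq_mul, Real.norm_eq_abs, Real.norm_eq_abs]
    rw [Real.dist_eq] at hd
    have h1 := hmax ν hν (L μ) (hLQ μ hμ)
    have h2 := hmax μ hμ (L ν) (hLQ ν hν)
    have h3 : |(D (L ν) - D (L μ)) * (ν - μ)| ≤ c * |ν - μ| := by
      rw [abs_mul]
      exact mul_le_mul_of_nonneg_right hd.le (abs_nonneg _)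
    have h4 := abs_le.1 h3
    rw [abs_le]
    constructor <;> nlinarith
  · rw [hphi μ hμ, hS, ← hL]
    field_simp
    ring
  · rw [← hL]
    linarith [hDnonneg _ (hLQ μ hμ)]
  · intro a ha b hb hab
    have ha : 0 < a := ha
    have hb : 0 < b := hb
    simp only
    rw [hphi a ha, hphi b hb]
    have := hmax a ha (L b) (hLQ b hb)
    nlinarith [mul_nonneg (sub_nonneg.2 hab) (hDnonneg _ (hLQ b hb))]
end

section
/- Assume in addition that D is differentiable on a neighborhood of Q. Then for every μ > 0 and all x, y ∈ H, the maximizer map satisfies the Lipschitz-type estimate ‖λ^μ(x) − λ^μ(y)‖₂ ≤ (1/(μσ)) ‖g(x) − g(y)‖₂, where g(x) := (g_1(x),…,g_m(x)) ∈ ℝ^m. -/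
open scoped BigOperators
open Set Filter

theorem quad_growth_aux {m : ℕ} (Q : Set (EuclideanSpace ℝ (Fin m)))
    (D : EuclideanSpace ℝ (Fin m) → ℝ) (σ : ℝ) (hσ : 0 < σ) (hD : StrongConvexOn Q σ D)
    (μ : ℝ) (hμ : 0 < μ) (c : Fin m → ℝ) (a : EuclideanSpace ℝ (Fin m)) (ha : a ∈ Q)
    (hmax : ∀ l ∈ Q, ∑ i, l i * c i - μ * D l ≤ ∑ i, a i * c i - μ * D a)
    (b : EuclideanSpace ℝ (Fin m)) (hb : b ∈ Q) :
    ∑ i, b i * c i - μ * D b + μ * (σ / 2 * ‖a - b‖ ^ 2) ≤ ∑ i, a i * c i - μ * D a := by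
  set N := σ / 2 * ‖a - b‖ ^ 2 with hN
  have hN0 : 0 ≤ N := by positivity
  have key : ∀ t : ℝ, 0 < t → t < 1 →
      ∑ i, b i * c i - μ * D b + (1 - t) * (μ * N) ≤ ∑ i, a i * c i - μ * D a := by
    intro t ht ht1
    have h1 := hD.2 ha hb (sub_nonneg.2 ht1.le) ht.le (by ring)
    have h2 := hmax _ (hD.1 ha hb (sub_nonneg.2 ht1.le) ht.le (by ring))
    have h3 : ∑ i, ((1 - t) • a + t • b) i * c i
        = (1 - t) * ∑ i, a i * c i + t * ∑ i, b i * c i := by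
      rw [Finset.mul_sum, Finset.mul_sum, ← Finset.sum_add_distrib]
      refine Finset.sum_congr rfl fun i _ => ?_
      simp
      ring
    rw [h3] at h2
    simp only [smul_eq_mul] at h1
    rw [← hN] at h1
    have h4 := mul_le_mul_of_nonneg_left h1 hμ.le
    refine le_of_mul_le_mul_left ?_ ht
    linarith
  have hB : 0 ≤ μ * N := by positivity
  generalize μ * N = B at *
  by_contra hcon
  push Not at hcon
  obtain ⟨e, he⟩ : ∃ e, e = ∑ i, b i * c i - μ * D b + B - (∑ i, a i * c i - μ * D a) := ⟨_, rfl⟩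
  have he0 : 0 < e := by linarith
  have h := key (e / (2 * (B + e))) (by positivity) (by rw [div_lt_one (by positivity)]; linarith)
  have h5 : e / (2 * (B + e)) * B ≤ e / 2 := by
    rw [div_mul_eq_mul_div, div_le_div_iff₀ (by positivity) (by positivity)]
    nlinarith
  linarith

theorem statement5 {H : Type*} [NormedAddCommGroup H] [InnerProductSpace ℝ H]
    [CompleteSpace H]
    (m : ℕ) (hm : 1 ≤ m)
    (g : Fin m → H → ℝ) (hg : ∀ i, ConvexOn ℝ Set.univ (g i))
    (Q : Set (EuclideanSpace ℝ (Fin m))) (hQne : Q.Nonempty) (hQcomp : IsCompact Q)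
    (hQconv : Convex ℝ Q) (hQpos : ∀ l ∈ Q, ∀ i, 0 ≤ l i)
    (D : EuclideanSpace ℝ (Fin m) → ℝ) (hDcont : Continuous D)
    (hDnonneg : ∀ l ∈ Q, 0 ≤ D l)
    (σ : ℝ) (hσ : 0 < σ) (hDsc : StrongConvexOn Q σ D)
    (hDinf : IsGLB (D '' Q) 0)
    (C : ℝ) (hC : IsLUB (D '' Q) C)
    -- `D` is differentiable on a neighborhood `U` of `Q`
    (U : Set (EuclideanSpace ℝ (Fin m))) (hUopen : IsOpen U) (hQU : Q ⊆ U)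
    (hDdiff : ∀ l ∈ U, DifferentiableAt ℝ D l)
    -- `lam μ x` is the unique maximizer over `Q` of `λ ↦ ∑ i, λ i * g i x - μ * D λ`
    (lam : ℝ → H → EuclideanSpace ℝ (Fin m))
    (hlam : ∀ μ > (0 : ℝ), ∀ x : H, lam μ x ∈ Q ∧
      ∀ l ∈ Q, ∑ i, l i * g i x - μ * D l ≤ ∑ i, (lam μ x) i * g i x - μ * D (lam μ x))
    (hlam_uniq : ∀ μ > (0 : ℝ), ∀ x : H, ∀ l ∈ Q,
      (∀ l' ∈ Q, ∑ i, l' i * g i x - μ * D l' ≤ ∑ i, l i * g i x - μ * D l) →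
      l = lam μ x) :
    ∀ μ > (0 : ℝ), ∀ x y : H,
      ‖lam μ x - lam μ y‖ ≤ (1 / (μ * σ)) * Real.sqrt (∑ i, (g i x - g i y) ^ 2) := by
  intro μ hμ x y
  obtain ⟨ha, hamax⟩ := hlam μ hμ x
  obtain ⟨hb, hbmax⟩ := hlam μ hμ y
  have h1 := quad_growth_aux Q D σ hσ hDsc μ hμ (fun i => g i x) _ ha hamax _ hb
  have h2 := quad_growth_aux Q D σ hσ hDsc μ hμ (fun i => g i y) _ hb hbmax _ ha
  rw [norm_sub_rev] at h2
  generalize lam μ x = a at *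
  generalize lam μ y = b at *
  have h3 : ∑ i, (a - b) i * (g i x - g i y) = ∑ i, a i * g i x - ∑ i, b i * g i x
      - (∑ i, a i * g i y - ∑ i, b i * g i y) := by
    simp only [← Finset.sum_sub_distrib]
    refine Finset.sum_congr rfl fun i _ => ?_
    simp
    ring
  have h4 := Real.sum_mul_le_sqrt_mul_sqrt Finset.univ (fun i => (a - b) i)
    (fun i => g i x - g i y)
  have h5 : √(∑ i, (a - b) i ^ 2) = ‖a - b‖ := by
    rw [EuclideanSpace.norm_eq]; simp
  rw [h5] at h4
  simp only at h1 h2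
  set G := √(∑ i, (g i x - g i y) ^ 2)
  have hG : 0 ≤ G := Real.sqrt_nonneg _
  have h6 : ‖a - b‖ * (μ * σ * ‖a - b‖) ≤ ‖a - b‖ * G := by linarith
  rw [one_div_mul_eq_div, le_div_iff₀ (by positivity)]
  rcases (norm_nonneg (a - b)).eq_or_lt with h0 | h0
  · rw [← h0]; simpa using hG
  · have := le_of_mul_le_mul_left h6 h0
    linarith
end

section
/- Assume that D is differentiable on a neighborhood of Q, that each g_i is Fréchet differentiable, and let B ⊂ H be a nonempty, closed, bounded and convex set on which each ∇g_i is Lipschitz continuous with constant L_i. Set M_Q := sup_{λ∈Q} ‖λ‖₁, L_g := ∑_{i=1}^m L_i, and G_B := ( ∑_{i=1}^m sup_{z∈B} ‖∇g_i(z)‖² )^{1/2}, assumed finite. Then for every μ > 0 and all x, y ∈ B, ‖∇φ_μ(x) − ∇φ_μ(y)‖ ≤ ( M_Q·L_g + G_B²/(μσ) ) ‖x − y‖. -/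
open scoped BigOperators
open Set Filter

lemma aux_inner {m : ℕ} (a b : EuclideanSpace ℝ (Fin m)) : inner ℝ a b = ∑ i, a i * b i := by
  rw [PiLp.inner_apply]
  exact Finset.sum_congr rfl fun i _ => by simp [mul_comm]

lemma aux_growth {m : ℕ} (Q : Set (EuclideanSpace ℝ (Fin m)))
    (D : EuclideanSpace ℝ (Fin m) → ℝ) (σ : ℝ) (hDsc : StrongConvexOn Q σ D)
    (μ : ℝ) (hμ : 0 < μ) (u a l : EuclideanSpace ℝ (Fin m)) (ha : a ∈ Q) (hl : l ∈ Q)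
    (hmax : ∀ k ∈ Q, inner ℝ k u - μ * D k ≤ inner ℝ a u - μ * D a) :
    inner ℝ l u - μ * D l + μ * σ / 2 * ‖l - a‖ ^ 2 ≤ inner ℝ a u - μ * D a := by
  have key : ∀ t ∈ Set.Ioo (0:ℝ) 1,
      inner ℝ l u - μ * D l + (1 - t) * (μ * σ / 2 * ‖l - a‖ ^ 2) ≤ inner ℝ a u - μ * D a := by
    rintro t ⟨ht0, ht1⟩
    have h1 := hDsc.2 hl ha ht0.le (sub_nonneg.2 ht1.le) (by ring)
    have h2 := hmax _ (hDsc.1 hl ha ht0.le (sub_nonneg.2 ht1.le) (by ring))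
    rw [inner_add_left, inner_smul_left, inner_smul_left] at h2
    simp only [smul_eq_mul, conj_trivial] at h1 h2
    have h3 := mul_le_mul_of_nonneg_left h1 hμ.le
    have : t * (inner ℝ l u - μ * D l + (1 - t) * (μ * σ / 2 * ‖l - a‖ ^ 2))
        ≤ t * (inner ℝ a u - μ * D a) := by
      nlinarith
    exact le_of_mul_le_mul_left this ht0
  have hT : Tendsto (fun t : ℝ => inner ℝ l u - μ * D l + (1 - t) * (μ * σ / 2 * ‖l - a‖ ^ 2))
      (nhdsWithin 0 (Set.Ioi 0))
      (nhds (inner ℝ l u - μ * D l + (1 - 0) * (μ * σ / 2 * ‖l - a‖ ^ 2))) := by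
    apply Tendsto.mono_left _ nhdsWithin_le_nhds
    apply Continuous.tendsto
    fun_prop
  have := le_of_tendsto hT (by
    filter_upwards [Ioo_mem_nhdsGT (show (0:ℝ) < 1 by norm_num)] with t ht using key t ht)
  simpa using this

lemma aux_lip {m : ℕ} (Q : Set (EuclideanSpace ℝ (Fin m)))
    (D : EuclideanSpace ℝ (Fin m) → ℝ) (σ : ℝ) (hσ : 0 < σ) (hDsc : StrongConvexOn Q σ D)
    (μ : ℝ) (hμ : 0 < μ) (u v a b : EuclideanSpace ℝ (Fin m)) (ha : a ∈ Q) (hb : b ∈ Q)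
    (hmaxa : ∀ k ∈ Q, inner ℝ k u - μ * D k ≤ inner ℝ a u - μ * D a)
    (hmaxb : ∀ k ∈ Q, inner ℝ k v - μ * D k ≤ inner ℝ b v - μ * D b) :
    ‖a - b‖ ≤ ‖u - v‖ / (μ * σ) := by
  have h1 := aux_growth Q D σ hDsc μ hμ u a b ha hb hmaxa
  have h2 := aux_growth Q D σ hDsc μ hμ v b a hb ha hmaxb
  rw [norm_sub_rev b a] at h1
  have h3 := real_inner_le_norm (a - b) (u - v)
  rw [inner_sub_left, inner_sub_right, inner_sub_right] at h3
  rw [le_div_iff₀ (by positivity)]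
  rcases (norm_nonneg (a - b)).eq_or_lt with h | h
  · rw [← h]; simp
  · have : ‖a - b‖ * (‖a - b‖ * (μ * σ)) ≤ ‖a - b‖ * ‖u - v‖ := by nlinarith
    exact le_of_mul_le_mul_left this h

lemma aux_grad {H : Type*} [NormedAddCommGroup H] [InnerProductSpace ℝ H] [CompleteSpace H]
    {m : ℕ} (g : Fin m → H → ℝ) (hgdiff : ∀ i, Differentiable ℝ (g i)) (φ : H → ℝ)
    (lam : H → EuclideanSpace ℝ (Fin m)) (c : ℝ) (x : H)
    (hlip : ∀ y, ‖lam y - lam x‖ ≤ ‖WithLp.toLp 2 (fun i => g i y) - WithLp.toLp 2 (fun i => g i x)‖ / c)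
    (hlo : ∀ y, φ x + ∑ i, lam x i * (g i y - g i x) ≤ φ y)
    (hup : ∀ y, φ y ≤ φ x + ∑ i, lam y i * (g i y - g i x)) :
    HasGradientAt φ (∑ i, lam x i • gradient (g i) x) x := by
  let G : H → EuclideanSpace ℝ (Fin m) := fun y => WithLp.toLp 2 (fun i => g i y)
  have hG : Differentiable ℝ G := by
    rw [differentiable_euclidean]
    exact hgdiff
  have hO : (fun y => G y - G x) =O[nhds x] fun y => y - x := (hG x).isBigO_sub
  have h1 : HasGradientAt (fun y => ∑ i, lam x i * (g i y - g i x))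
      (∑ i, lam x i • gradient (g i) x) x := by
    rw [hasGradientAt_iff_hasFDerivAt]
    have : ∀ i ∈ Finset.univ, HasFDerivAt (fun y => lam x i * (g i y - g i x))
        (lam x i • (InnerProductSpace.toDual ℝ H (gradient (g i) x))) x := fun i _ =>
      ((hgdiff i x).hasGradientAt.hasFDerivAt.sub_const _).const_mul _
    have e : InnerProductSpace.toDual ℝ H (∑ i, lam x i • gradient (g i) x) =
        ∑ i, lam x i • InnerProductSpace.toDual ℝ H (gradient (g i) x) := by
      rw [map_sum]
      exact Finset.sum_congr rfl fun i _ => by rw [map_smulₛₗ]; rfl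
    rw [e]
    exact HasFDerivAt.fun_sum this
  have h2 : (fun y => φ y - φ x - ∑ i, lam x i * (g i y - g i x)) =o[nhds x] fun y => y - x := by
    have hb : (fun y => φ y - φ x - ∑ i, lam x i * (g i y - g i x)) =O[nhds x]
        fun y => ‖y - x‖ * ‖y - x‖ := by
      refine Asymptotics.IsBigO.trans (g := fun y => ‖G y - G x‖ * ‖G y - G x‖) ?_
        (hO.norm_norm.mul hO.norm_norm)
      refine Asymptotics.IsBigO.of_bound c⁻¹ (Eventually.of_forall fun y => ?_)
      have e := real_inner_le_norm (lam y - lam x) (G y - G x)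
      rw [aux_inner] at e
      have e2 : ∑ i, (lam y - lam x) i * (G y - G x) i = ∑ i, lam y i * (g i y - g i x) -
          ∑ i, lam x i * (g i y - g i x) := by
        rw [← Finset.sum_sub_distrib]
        exact Finset.sum_congr rfl fun i _ => by simp [G]; ring
      have e3 := mul_le_mul_of_nonneg_right (hlip y) (norm_nonneg (G y - G x))
      have l := hlo y
      have u := hup y
      rw [Real.norm_eq_abs, abs_of_nonneg (by linarith), norm_mul, norm_norm]
      have : c⁻¹ * (‖G y - G x‖ * ‖G y - G x‖) = ‖G y - G x‖ / c * ‖G y - G x‖ := by ring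
      rw [this]
      change _ ≤ ‖G y - G x‖ / c * ‖G y - G x‖ at e3
      linarith
    refine hb.trans_isLittleO ?_
    have ht : (fun y => ‖y - x‖) =o[nhds x] fun _ => (1:ℝ) := by
      rw [Asymptotics.isLittleO_one_iff]
      have : Continuous fun y => ‖y - x‖ := by fun_prop
      simpa using this.tendsto x
    have h3 := ht.mul_isBigO (Asymptotics.isBigO_refl (fun y => ‖y - x‖) (nhds x))
    simp only [one_mul] at h3
    exact h3.of_norm_right
  rw [hasGradientAt_iff_isLittleO] at h1 ⊢
  refine (h1.add h2).congr_left fun y => ?_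
  simp

theorem statement6 {H : Type*} [NormedAddCommGroup H] [InnerProductSpace ℝ H]
    [CompleteSpace H]
    (m : ℕ) (hm : 1 ≤ m)
    (g : Fin m → H → ℝ) (hg : ∀ i, ConvexOn ℝ Set.univ (g i))
    (hgdiff : ∀ i, Differentiable ℝ (g i))
    (Q : Set (EuclideanSpace ℝ (Fin m))) (hQne : Q.Nonempty) (hQcomp : IsCompact Q)
    (hQconv : Convex ℝ Q) (hQpos : ∀ l ∈ Q, ∀ i, 0 ≤ l i)
    (D : EuclideanSpace ℝ (Fin m) → ℝ) (hDcont : Continuous D)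
    (hDnonneg : ∀ l ∈ Q, 0 ≤ D l)
    (σ : ℝ) (hσ : 0 < σ) (hDsc : StrongConvexOn Q σ D)
    (hDinf : IsGLB (D '' Q) 0)
    (C : ℝ) (hC : IsLUB (D '' Q) C)
    -- `D` is differentiable on a neighborhood `U` of `Q`
    (U : Set (EuclideanSpace ℝ (Fin m))) (hUopen : IsOpen U) (hQU : Q ⊆ U)
    (hDdiff : ∀ l ∈ U, DifferentiableAt ℝ D l)
    -- `B` is a nonempty, closed, bounded, convex subset of `H`
    (B : Set H) (hBne : B.Nonempty) (hBclosed : IsClosed B)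
    (hBbounded : Bornology.IsBounded B) (hBconv : Convex ℝ B)
    -- each `∇ g i` is Lipschitz on `B` with constant `L i`
    (L : Fin m → ℝ)
    (hLip : ∀ i, ∀ x ∈ B, ∀ y ∈ B,
      ‖gradient (g i) x - gradient (g i) y‖ ≤ L i * ‖x - y‖)
    -- `MQ = sup_{λ ∈ Q} ‖λ‖₁`
    (MQ : ℝ) (hMQ : IsLUB ((fun l : EuclideanSpace ℝ (Fin m) => ∑ i, |l i|) '' Q) MQ)
    -- `Gsup i = sup_{z ∈ B} ‖∇ g i z‖`, assumed finite
    (Gsup : Fin m → ℝ)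
    (hGsup : ∀ i, IsLUB ((fun z => ‖gradient (g i) z‖) '' B) (Gsup i)) :
    ∀ μ > (0 : ℝ), ∀ x ∈ B, ∀ y ∈ B,
      ‖gradient (phiMu m g Q D μ) x - gradient (phiMu m g Q D μ) y‖ ≤
        (MQ * (∑ i, L i) + (Real.sqrt (∑ i, Gsup i ^ 2)) ^ 2 / (μ * σ)) * ‖x - y‖ := by
  intro μ hμ x hx y hy
  let G : H → EuclideanSpace ℝ (Fin m) := fun y => WithLp.toLp 2 (fun i => g i y)
  have hex : ∀ z : H, ∃ a ∈ Q, ∀ k ∈ Q, inner ℝ k (G z) - μ * D k ≤ inner ℝ a (G z) - μ * D a := by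
    intro z
    obtain ⟨a, ha, h⟩ := hQcomp.exists_isMaxOn hQne
      (f := fun k => inner ℝ k (G z) - μ * D k) (by fun_prop)
    exact ⟨a, ha, fun k hk => h hk⟩
  choose lam hlamQ hlam using hex
  have hphi : ∀ z, phiMu m g Q D μ z = inner ℝ (lam z) (G z) - μ * D (lam z) := by
    intro z
    unfold phiMu
    have : (fun l : EuclideanSpace ℝ (Fin m) => ∑ i, l i * g i z - μ * D l) =
        fun l => inner ℝ l (G z) - μ * D l := by
      funext l; rw [aux_inner]
    rw [this]
    refine IsGreatest.csSup_eq ⟨⟨lam z, hlamQ z, rfl⟩, ?_⟩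
    rintro _ ⟨k, hk, rfl⟩
    exact hlam z k hk
  have hll : ∀ z w, ‖lam z - lam w‖ ≤ ‖G z - G w‖ / (μ * σ) := fun z w =>
    aux_lip Q D σ hσ hDsc μ hμ _ _ _ _ (hlamQ z) (hlamQ w) (hlam z) (hlam w)
  have hsum : ∀ (a : EuclideanSpace ℝ (Fin m)) z w,
      ∑ i, a i * (g i z - g i w) = inner ℝ a (G z) - inner ℝ a (G w) := by
    intro a z w
    rw [← inner_sub_right, aux_inner]; rfl
  have hgr : ∀ z, gradient (phiMu m g Q D μ) z = ∑ i, lam z i • gradient (g i) z := by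
    intro z
    refine (aux_grad g hgdiff _ lam (μ * σ) z (fun w => hll w z) ?_ ?_).gradient
    · intro w
      rw [hsum, hphi, hphi]
      linarith [hlam w _ (hlamQ z)]
    · intro w
      rw [hsum, hphi, hphi]
      linarith [hlam z _ (hlamQ w)]
  rcases eq_or_ne x y with rfl | hxy
  · simp
  have hd : 0 < ‖x - y‖ := norm_pos_iff.2 (sub_ne_zero.2 hxy)
  have hL : ∀ i, 0 ≤ L i := fun i =>
    nonneg_of_mul_nonneg_left ((norm_nonneg _).trans (hLip i x hx y hy)) hd
  have hGb : ∀ i, ∀ z ∈ B, ‖gradient (g i) z‖ ≤ Gsup i := fun i z hz =>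
    (hGsup i).1 ⟨z, hz, rfl⟩
  have hG0 : ∀ i, 0 ≤ Gsup i := fun i => (norm_nonneg _).trans (hGb i x hx)
  set S := Real.sqrt (∑ i, Gsup i ^ 2) with hS
  have hS0 : 0 ≤ S := Real.sqrt_nonneg _
  have hGG : ‖G x - G y‖ ≤ S * ‖x - y‖ := by
    rw [EuclideanSpace.norm_eq, hS, ← Real.sqrt_sq hd.le,
      ← Real.sqrt_mul (Finset.sum_nonneg fun i _ => sq_nonneg _), Finset.sum_mul]
    apply Real.sqrt_le_sqrt
    refine Finset.sum_le_sum fun i _ => ?_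
    rw [← mul_pow]
    refine pow_le_pow_left₀ (norm_nonneg _) ?_ 2
    refine hBconv.norm_image_sub_le_of_norm_hasFDerivWithin_le (f := g i)
      (f' := fun z => InnerProductSpace.toDual ℝ H (gradient (g i) z))
      (fun z _ => (hgdiff i z).hasGradientAt.hasFDerivAt.hasFDerivWithinAt) ?_ hy hx
    intro z hz
    rw [LinearIsometryEquiv.norm_map]
    exact hGb i z hz
  have hlamM : ∀ i, |lam x i| ≤ MQ := fun i =>
    (Finset.single_le_sum (f := fun i => |lam x i|) (fun j _ => abs_nonneg _)
      (Finset.mem_univ i)).trans (hMQ.1 ⟨lam x, hlamQ x, rfl⟩)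
  rw [hgr, hgr]
  have hsplit : ∑ i, lam x i • gradient (g i) x - ∑ i, lam y i • gradient (g i) y =
      ∑ i, lam x i • (gradient (g i) x - gradient (g i) y) +
        ∑ i, (lam x i - lam y i) • gradient (g i) y := by
    rw [← Finset.sum_sub_distrib, ← Finset.sum_add_distrib]
    exact Finset.sum_congr rfl fun i _ => by rw [smul_sub, sub_smul]; abel
  have hA : ‖∑ i, lam x i • (gradient (g i) x - gradient (g i) y)‖ ≤
      MQ * (∑ i, L i) * ‖x - y‖ := by
    rw [Finset.mul_sum, Finset.sum_mul]
    refine norm_sum_le_of_le _ fun i _ => ?_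
    rw [norm_smul, Real.norm_eq_abs, mul_assoc]
    exact mul_le_mul (hlamM i) (hLip i x hx y hy) (norm_nonneg _)
      ((abs_nonneg _).trans (hlamM i))
  have hB1 : ‖∑ i, (lam x i - lam y i) • gradient (g i) y‖ ≤ ‖lam x - lam y‖ * S := by
    refine (norm_sum_le_of_le (f := fun i => (lam x i - lam y i) • gradient (g i) y) _
      (n := fun i => |lam x i - lam y i| * Gsup i) fun i _ => ?_).trans ?_
    · rw [norm_smul, Real.norm_eq_abs]
      exact mul_le_mul_of_nonneg_left (hGb i y hy) (abs_nonneg _)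
    · refine (Real.sum_mul_le_sqrt_mul_sqrt _ _ _).trans (le_of_eq ?_)
      rw [EuclideanSpace.norm_eq]
      simp [hS]
  have hB2 : ‖lam x - lam y‖ * S ≤ S ^ 2 / (μ * σ) * ‖x - y‖ := by
    have h := (hll x y).trans (div_le_div_of_nonneg_right hGG (by positivity))
    refine (mul_le_mul_of_nonneg_right h hS0).trans (le_of_eq ?_)
    ring
  rw [hsplit, add_mul]
  exact (norm_add_le _ _).trans (add_le_add hA (hB1.trans hB2))
end

section
/- The energy E is differentiable on [t0,∞) and for every t ≥ t0 its derivative satisfies Ė(t) ≤ ( C(α−3)/(α−1)² ) t μ(t) + ( C/(α−1)² ) t² |μ̇(t)|. -/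
open scoped BigOperators
open Set Filter MeasureTheory

/-- The supremum function `φ(x) = max_{λ ∈ Q} ∑ i, λ_i g_i(x)`. -/
noncomputable def phi {H : Type*} (m : ℕ) (g : Fin m → H → ℝ)
    (Q : Set (EuclideanSpace ℝ (Fin m))) (x : H) : ℝ :=
  sSup ((fun l : EuclideanSpace ℝ (Fin m) => ∑ i, l i * g i x) '' Q)

open scoped Topology in
lemma aux_danskin {W : Type*} [NormedAddCommGroup W] [NormedSpace ℝ W]
    (K : Set (W →L[ℝ] ℝ)) (hK : IsCompact K) (k0 : W →L[ℝ] ℝ) (hk0 : k0 ∈ K) (w : W)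
    (huniq : ∀ k ∈ K, k ≠ k0 → k w < k0 w) :
    HasFDerivAt (fun v => sSup ((fun k : W →L[ℝ] ℝ => k v) '' K)) k0 w := by
  have hcont : ∀ v : W, Continuous (fun k : W →L[ℝ] ℝ => k v) := fun v => by fun_prop
  have hmax : ∀ v : W, ∃ k ∈ K, sSup ((fun k : W →L[ℝ] ℝ => k v) '' K) = k v ∧
      ∀ j ∈ K, j v ≤ k v := by
    intro v
    obtain ⟨k, hk, h1, h2⟩ := hK.exists_sSup_image_eq_and_ge ⟨k0, hk0⟩ (hcont v).continuousOn
    exact ⟨k, hk, h1, h2⟩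
  have hSw : sSup ((fun k : W →L[ℝ] ℝ => k w) '' K) = k0 w := by
    obtain ⟨k, hk, h1, h2⟩ := hmax w
    rw [h1]
    by_contra hne
    have : k ≠ k0 := fun h => hne (by rw [h])
    exact absurd (h2 k0 hk0) (not_le.2 (huniq k hk this))
  obtain ⟨R, hR⟩ := hK.isBounded.exists_norm_le
  have hR0 : 0 ≤ R := (norm_nonneg _).trans (hR k0 hk0)
  refine HasFDerivAt.of_isLittleO (Asymptotics.isLittleO_iff.2 ?_)
  intro c hc
  have hδ : ∃ δ > 0, ∀ k ∈ K, c ≤ ‖k - k0‖ → k w ≤ k0 w - δ := by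
    have hK' : IsCompact (K ∩ {k | c ≤ ‖k - k0‖}) :=
      hK.inter_right (isClosed_le continuous_const (by fun_prop))
    rcases (K ∩ {k | c ≤ ‖k - k0‖}).eq_empty_or_nonempty with he | hne
    · refine ⟨1, one_pos, fun k hk h => ?_⟩
      have : k ∈ K ∩ {k | c ≤ ‖k - k0‖} := ⟨hk, h⟩
      rw [he] at this
      exact this.elim
    · obtain ⟨k1, hk1, h1⟩ := hK'.exists_isMaxOn hne (hcont w).continuousOn
      have hne1 : k1 ≠ k0 := by
        rintro rfl
        have := hk1.2
        simp at this
        linarith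
      refine ⟨k0 w - k1 w, sub_pos.2 (huniq k1 hk1.1 hne1), fun k hk h => ?_⟩
      have : k w ≤ k1 w := h1 ⟨hk, h⟩
      linarith
  obtain ⟨δ, hδ0, hδ⟩ := hδ
  have hev : ∀ᶠ v in 𝓝 w, 2 * R * ‖v - w‖ < δ := by
    have : Tendsto (fun v => 2 * R * ‖v - w‖) (𝓝 w) (𝓝 (2 * R * ‖w - w‖)) :=
      (by fun_prop : Continuous (fun v => 2 * R * ‖v - w‖)).tendsto w
    simp only [sub_self, norm_zero, mul_zero] at this
    exact this.eventually (gt_mem_nhds hδ0)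
  filter_upwards [hev] with v hv
  obtain ⟨k, hk, h1, h2⟩ := hmax v
  rw [h1, hSw]
  have hb1 : |k (v - w)| ≤ R * ‖v - w‖ :=
    (k.le_opNorm _).trans (mul_le_mul_of_nonneg_right (hR k hk) (norm_nonneg _))
  have hb2 : |k0 (v - w)| ≤ R * ‖v - w‖ :=
    (k0.le_opNorm _).trans (mul_le_mul_of_nonneg_right (hR k0 hk0) (norm_nonneg _))
  have h20 := h2 k0 hk0
  have e1 : k (v - w) = k v - k w := map_sub k v w
  have e2 : k0 (v - w) = k0 v - k0 w := map_sub k0 v w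
  have hclose : ‖k - k0‖ < c := by
    by_contra hcon
    have := hδ k hk (not_lt.1 hcon)
    have a1 := (abs_le.1 hb1).2
    have a2 := (abs_le.1 hb2).1
    linarith
  have hb3 : |k (v - w) - k0 (v - w)| ≤ c * ‖v - w‖ :=
    ((k - k0).le_opNorm (v - w)).trans
      (mul_le_mul_of_nonneg_right hclose.le (norm_nonneg _))
  have hkw : k w ≤ k0 w := by
    by_cases h : k = k0
    · rw [h]
    · exact (huniq k hk h).le
  rw [Real.norm_eq_abs, abs_of_nonneg (by linarith)]
  have := (abs_le.1 hb3).2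
  linarith

lemma aux_convex {H : Type*} [NormedAddCommGroup H] [NormedSpace ℝ H]
    (f : H → ℝ) (hf : ConvexOn ℝ Set.univ f) (hd : Differentiable ℝ f) (x y : H) :
    f x - f y ≤ fderiv ℝ f x (x - y) := by
  have hline : ConvexOn ℝ Set.univ (fun s : ℝ => f (AffineMap.lineMap x y s)) := by
    have := hf.comp_affineMap (AffineMap.lineMap x y : ℝ →ᵃ[ℝ] H)
    rw [Set.preimage_univ] at this
    exact this
  have hder : HasDerivAt (fun s : ℝ => f (AffineMap.lineMap x y s)) (fderiv ℝ f x (y - x)) 0 := by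
    have h1 : HasDerivAt (fun s : ℝ => (AffineMap.lineMap x y s : H)) (y - x) 0 :=
      AffineMap.hasDerivAt_lineMap
    have h2 : HasFDerivAt f (fderiv ℝ f x) (AffineMap.lineMap x y (0:ℝ)) := by
      simpa using (hd x).hasFDerivAt
    exact h2.comp_hasDerivAt _ h1
  have := hline.le_slope_of_hasDerivAt (Set.mem_univ 0) (Set.mem_univ 1) one_pos hder
  simp [slope_def_field] at this
  have e : fderiv ℝ f x (x - y) = - fderiv ℝ f x (y - x) := by rw [← map_neg, neg_sub]
  rw [e, map_sub]
  linarith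

/-- the functional attached to `l`. -/
noncomputable def auxK (m : ℕ) (D : EuclideanSpace ℝ (Fin m) → ℝ)
    (l : EuclideanSpace ℝ (Fin m)) : ((Fin m → ℝ) × ℝ) →L[ℝ] ℝ :=
  (∑ i, l i • ((ContinuousLinearMap.proj i : (Fin m → ℝ) →L[ℝ] ℝ).comp
    (ContinuousLinearMap.fst ℝ (Fin m → ℝ) ℝ))) - D l • ContinuousLinearMap.snd ℝ (Fin m → ℝ) ℝ

lemma auxK_apply (m : ℕ) (D : EuclideanSpace ℝ (Fin m) → ℝ)
    (l : EuclideanSpace ℝ (Fin m)) (w : (Fin m → ℝ) × ℝ) :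
    auxK m D l w = ∑ i, l i * w.1 i - w.2 * D l := by
  simp [auxK, mul_comm]

lemma auxS_hasFDerivAt (m : ℕ) 
    (Q : Set (EuclideanSpace ℝ (Fin m))) (hQne : Q.Nonempty) (hQcomp : IsCompact Q)
    (D : EuclideanSpace ℝ (Fin m) → ℝ) (hDcont : Continuous D)
    (hDsc : StrictConvexOn ℝ Q D) (w : (Fin m → ℝ) × ℝ) (hw : 0 < w.2) :
    ∃ l ∈ Q, HasFDerivAt (fun v : (Fin m → ℝ) × ℝ =>
      sSup ((fun l : EuclideanSpace ℝ (Fin m) => ∑ i, l i * v.1 i - v.2 * D l) '' Q))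
      (auxK m D l) w ∧
      sSup ((fun l : EuclideanSpace ℝ (Fin m) => ∑ i, l i * w.1 i - w.2 * D l) '' Q)
        = ∑ i, l i * w.1 i - w.2 * D l := by
  have hc : Continuous (auxK m D) := by
    unfold auxK
    fun_prop
  have hcQ : Continuous (fun l : EuclideanSpace ℝ (Fin m) => ∑ i, l i * w.1 i - w.2 * D l) := by
    fun_prop
  obtain ⟨l, hl, h1, h2⟩ := hQcomp.exists_sSup_image_eq_and_ge hQne hcQ.continuousOn
  refine ⟨l, hl, ?_, h1⟩
  have key := aux_danskin (auxK m D '' Q) (hQcomp.image hc) (auxK m D l) ⟨l, hl, rfl⟩ w ?_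
  · simp only [Set.image_image, auxK_apply] at key
    exact key
  · rintro _ ⟨j, hj, rfl⟩ hne
    have hjl : j ≠ l := fun h => hne (by rw [h])
    rw [auxK_apply, auxK_apply]
    have hmid : (1/2 : ℝ) • j + (1/2 : ℝ) • l ∈ Q :=
      hDsc.1 hj hl (by norm_num) (by norm_num) (by norm_num)
    have hs := hDsc.2 hj hl hjl (by norm_num : (0:ℝ) < 1/2) (by norm_num : (0:ℝ) < 1/2)
      (by norm_num)
    have h3 := h2 _ hmid
    have h4 := h2 _ hj
    have hsum : ∑ i, ((1/2 : ℝ) • j + (1/2 : ℝ) • l) i * w.1 i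
        = 1/2 * ∑ i, j i * w.1 i + 1/2 * ∑ i, l i * w.1 i := by
      rw [Finset.mul_sum, Finset.mul_sum, ← Finset.sum_add_distrib]
      refine Finset.sum_congr rfl fun i _ => ?_
      simp
      ring
    simp only [hsum] at h3
    simp only [smul_eq_mul] at hs
    have := mul_lt_mul_of_pos_left hs hw
    linarith

theorem statement8 {H : Type*} [NormedAddCommGroup H] [InnerProductSpace ℝ H]
    [CompleteSpace H]
    (m : ℕ) (hm : 1 ≤ m)
    (g : Fin m → H → ℝ) (hg : ∀ i, ConvexOn ℝ Set.univ (g i))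
    (hgdiff : ∀ i, Differentiable ℝ (g i))
    -- each `∇ g i` is Lipschitz continuous on every bounded set
    (hgradLip : ∀ i, ∀ s : Set H, Bornology.IsBounded s →
      ∃ Li : ℝ, ∀ x ∈ s, ∀ y ∈ s,
        ‖gradient (g i) x - gradient (g i) y‖ ≤ Li * ‖x - y‖)
    (Q : Set (EuclideanSpace ℝ (Fin m))) (hQne : Q.Nonempty) (hQcomp : IsCompact Q)
    (hQconv : Convex ℝ Q) (hQpos : ∀ l ∈ Q, ∀ i, 0 ≤ l i)
    (D : EuclideanSpace ℝ (Fin m) → ℝ) (hDcont : Continuous D)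
    (hDnonneg : ∀ l ∈ Q, 0 ≤ D l)
    (σ : ℝ) (hσ : 0 < σ) (hDsc : StrongConvexOn Q σ D)
    (hDinf : IsGLB (D '' Q) 0)
    (C : ℝ) (hC : IsLUB (D '' Q) C)
    -- `D` is differentiable on a neighborhood `U` of `Q`
    (U : Set (EuclideanSpace ℝ (Fin m))) (hUopen : IsOpen U) (hQU : Q ⊆ U)
    (hDdiff : ∀ l ∈ U, DifferentiableAt ℝ D l)
    -- `xstar` is a minimizer of `φ` (so `inf φ = φ xstar`)
    (xstar : H) (hstar : ∀ y : H, phi m g Q xstar ≤ phi m g Q y)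
    -- time data
    (t0 α : ℝ) (ht0 : 0 < t0) (hα : 3 ≤ α)
    -- `μ` is continuously differentiable, positive and nonincreasing on `[t0, ∞)`
    (μ μ' : ℝ → ℝ) (hμpos : ∀ t ∈ Set.Ici t0, 0 < μ t)
    (hμderiv : ∀ t ∈ Set.Ici t0, HasDerivAt μ (μ' t) t)
    (hμ'cont : ContinuousOn μ' (Set.Ici t0))
    (hμanti : AntitoneOn μ (Set.Ici t0))
    -- `x` is a twice continuously differentiable solution of the inertial system
    (x x' x'' : ℝ → H)
    (hx' : ∀ t ∈ Set.Ici t0, HasDerivAt x (x' t) t)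
    (hx'' : ∀ t ∈ Set.Ici t0, HasDerivAt x' (x'' t) t)
    (hx''cont : ContinuousOn x'' (Set.Ici t0))
    (hODE : ∀ t ∈ Set.Ici t0,
      x'' t + (α / t) • x' t + gradient (phiMu m g Q D (μ t)) (x t) = 0)
 :
    ∀ t ∈ Set.Ici t0, ∃ E' : ℝ,
      HasDerivAt (fun s : ℝ =>
        (1 / 2) * ‖x s - xstar + (s / (α - 1)) • x' s‖ ^ 2 +
          (s ^ 2 / (α - 1) ^ 2) * (phiMu m g Q D (μ s) (x s) - phi m g Q xstar)) E' t ∧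
      E' ≤ C * (α - 3) / (α - 1) ^ 2 * (t * μ t) + C / (α - 1) ^ 2 * (t ^ 2 * |μ' t|) := by
  intro t ht
  have htpos : 0 < t := lt_of_lt_of_le ht0 ht
  have hmut := hμpos t ht
  obtain ⟨l, hl, hS, hval⟩ := auxS_hasFDerivAt m Q hQne hQcomp D hDcont
    (hDsc.strictConvexOn hσ) (fun i => g i (x t), μ t) hmut
  have hphiMu : ∀ (a : ℝ) (y : H), phiMu m g Q D a y =
      (fun v : (Fin m → ℝ) × ℝ =>
      sSup ((fun l : EuclideanSpace ℝ (Fin m) => ∑ i, l i * v.1 i - v.2 * D l) '' Q))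
      (fun i => g i y, a) := fun a y => rfl
  -- gradient of phiMu
  have hG : HasFDerivAt (phiMu m g Q D (μ t)) ((auxK m D l).comp
      ((ContinuousLinearMap.pi fun i => fderiv ℝ (g i) (x t)).prod 0)) (x t) := by
    have h1 : HasFDerivAt (fun y : H => ((fun i => g i y, μ t) : (Fin m → ℝ) × ℝ))
        ((ContinuousLinearMap.pi fun i => fderiv ℝ (g i) (x t)).prod 0) (x t) :=
      (hasFDerivAt_pi.2 fun i => (hgdiff i (x t)).hasFDerivAt).prodMk (hasFDerivAt_const _ _)
    exact hS.comp (x t) h1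
  set G := gradient (phiMu m g Q D (μ t)) (x t) with hGdef
  have hGin : ∀ v : H, inner ℝ G v = ∑ i, l i * fderiv ℝ (g i) (x t) v := by
    intro v
    rw [hGdef, gradient, InnerProductSpace.toDual_symm_apply, hG.fderiv]
    simp [auxK_apply]
  have hH : HasDerivAt (fun s => phiMu m g Q D (μ s) (x s))
      (inner ℝ G (x' t) - μ' t * D l) t := by
    have h1 : HasDerivAt (fun s : ℝ => ((fun i => g i (x s), μ s) : (Fin m → ℝ) × ℝ))
        (fun i => fderiv ℝ (g i) (x t) (x' t), μ' t) t :=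
      (hasDerivAt_pi.2 fun i =>
        (hgdiff i (x t)).hasFDerivAt.comp_hasDerivAt t (hx' t ht)).prodMk (hμderiv t ht)
    have h2 := hS.comp_hasDerivAt t h1
    rw [auxK_apply] at h2
    rw [hGin]
    exact h2
  -- bounds
  have hDl0 := hDnonneg l hl
  have hDlC : D l ≤ C := hC.1 ⟨l, hl, rfl⟩
  have hC0 : 0 ≤ C := hDl0.trans hDlC
  have hbdd : ∀ y : H, BddAbove ((fun l : EuclideanSpace ℝ (Fin m) => ∑ i, l i * g i y) '' Q) :=
    fun y => hQcomp.bddAbove_image (Continuous.continuousOn (by fun_prop))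
  have hbddMu : ∀ y : H, BddAbove
      ((fun l : EuclideanSpace ℝ (Fin m) => ∑ i, l i * g i y - μ t * D l) '' Q) :=
    fun y => hQcomp.bddAbove_image (Continuous.continuousOn (by fun_prop))
  set ζ := phiMu m g Q D (μ t) (x t) - phi m g Q xstar with hζ
  have hval' : phiMu m g Q D (μ t) (x t) = ∑ i, l i * g i (x t) - μ t * D l := hval
  have hlow : -(μ t * C) ≤ ζ := by
    have h1 : phi m g Q (x t) ≤ phiMu m g Q D (μ t) (x t) + μ t * C := by
      refine csSup_le (hQne.image _) ?_
      rintro _ ⟨j, hj, rfl⟩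
      have h2 : ∑ i, j i * g i (x t) - μ t * D j ≤ phiMu m g Q D (μ t) (x t) :=
        le_csSup (hbddMu (x t)) ⟨j, hj, rfl⟩
      have h3 : D j ≤ C := hC.1 ⟨j, hj, rfl⟩
      have h4 := mul_le_mul_of_nonneg_left h3 hmut.le
      simp only
      linarith
    have := hstar (x t)
    linarith
  have hconv : ζ ≤ inner ℝ G (x t - xstar) := by
    rw [hGin]
    have h1 : ∑ i, l i * (g i (x t) - g i xstar)
        ≤ ∑ i, l i * fderiv ℝ (g i) (x t) (x t - xstar) :=
      Finset.sum_le_sum fun i _ => mul_le_mul_of_nonneg_left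
        (aux_convex (g i) (hg i) (hgdiff i) (x t) xstar) (hQpos l hl i)
    have h2 : ∑ i, l i * g i xstar ≤ phi m g Q xstar := le_csSup (hbdd xstar) ⟨l, hl, rfl⟩
    simp only [mul_sub, Finset.sum_sub_distrib] at h1
    have := mul_nonneg hmut.le hDl0
    linarith
  have hα1 : 0 < α - 1 := by linarith
  -- derivative of v
  have hv : HasDerivAt (fun s : ℝ => x s - xstar + (s / (α - 1)) • x' s)
      (-(t / (α - 1)) • G) t := by
    have h1 := ((hx' t ht).sub_const xstar).add
      (((hasDerivAt_id t).div_const (α - 1)).smul (hx'' t ht))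
    refine h1.congr_deriv ?_
    have h2 : x'' t = -(α / t) • x' t - G := by
      have := hODE t ht
      rw [neg_smul, sub_eq_add_neg, ← neg_add]
      rw [add_assoc] at this
      exact eq_neg_of_add_eq_zero_left this
    rw [h2]
    simp only [id]
    match_scalars
    · field_simp
      ring
    · ring
  have hE := ((hv.norm_sq).const_mul (1/2)).add
    ((((hasDerivAt_id t).pow 2).div_const ((α - 1) ^ 2)).mul
      (hH.sub_const (phi m g Q xstar)))
  refine ⟨_, hE, ?_⟩
  rw [← hζ]
  simp only [id, inner_smul_right, inner_add_left, real_inner_smul_left]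
  rw [real_inner_comm G (x t - xstar), real_inner_comm G (x' t)]
  set P := inner ℝ G (x t - xstar)
  set R := inner ℝ G (x' t)
  have hP : t / (α - 1) * ζ ≤ t / (α - 1) * P :=
    mul_le_mul_of_nonneg_left hconv (by positivity)
  have hmu' : -(μ' t * D l) ≤ C * |μ' t| := by
    have h1 : -(μ' t * D l) ≤ |μ' t| * D l := by
      have := mul_le_mul_of_nonneg_right (neg_le_abs (μ' t)) hDl0
      linarith
    have h2 := mul_le_mul_of_nonneg_left hDlC (abs_nonneg (μ' t))
    linarith
  have h5 : t ^ 2 / (α - 1) ^ 2 * (-(μ' t * D l)) ≤ t ^ 2 / (α - 1) ^ 2 * (C * |μ' t|) :=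
    mul_le_mul_of_nonneg_left hmu' (by positivity)
  have h6 : (α - 3) * t / (α - 1) ^ 2 * (-(μ t * C)) ≤ (α - 3) * t / (α - 1) ^ 2 * ζ :=
    mul_le_mul_of_nonneg_left hlow
      (div_nonneg (mul_nonneg (by linarith) htpos.le) (by positivity))
  have h7 : t / (α - 1) * ζ = (α - 3) * t / (α - 1) ^ 2 * ζ + 2 * t / (α - 1) ^ 2 * ζ := by
    field_simp
    ring
  have h8 : t / (α - 1) * (t / (α - 1)) * R = t ^ 2 / (α - 1) ^ 2 * R := by
    field_simp
  have h9 : C * (α - 3) / (α - 1) ^ 2 * (t * μ t) + C / (α - 1) ^ 2 * (t ^ 2 * |μ' t|)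
     = -((α - 3) * t / (α - 1) ^ 2 * (-(μ t * C))) + t ^ 2 / (α - 1) ^ 2 * (C * |μ' t|) := by
    ring
  rw [h9]
  refine le_trans (le_of_eq ?_) (show -(t / (α - 1) * P) + 2 * t / (α - 1) ^ 2 * ζ
    + t ^ 2 / (α - 1) ^ 2 * (-(μ' t * D l)) ≤ _ by linarith)
  simp
  field_simp
  ring
end

section
/- Under Assumption A, the function v is bounded on [t0,∞), the limit lim_{t→∞} E(t) exists and is finite, and there exists a constant K > 0 such that |φ_{μ(t)}(x(t)) − inf φ| ≤ K/t² for all t ≥ t0. -/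
open scoped BigOperators
open Set Filter MeasureTheory

lemma aux_antitone (t0 : ℝ) (f B b : ℝ → ℝ) (hf : ContinuousOn f (Ici t0))
    (hB : ∀ t ∈ Ici t0, HasDerivAt B (b t) t)
    (hp : ∀ t ∈ Ici t0, ∃ (p : ℝ → ℝ) (p' : ℝ), HasDerivAt p p' t ∧ p' ≤ b t ∧ p t = f t ∧
      ∀ s, t ≤ s → f s ≤ p s) :
    AntitoneOn (fun t => f t - B t) (Ici t0) := by
  intro a ha c hc hac
  have hsub : Icc a c ⊆ Ici t0 := fun z hz => le_trans ha hz.1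
  have key := image_le_of_liminf_slope_right_le_deriv_boundary (f := f) (a := a) (b := c)
    (B := fun t => B t + (f a - B a)) (B' := b) (hf.mono hsub) (by simp)
    (fun z hz => ((hB z (hsub hz)).continuousAt.add continuousAt_const).continuousWithinAt)
    (fun z hz => ((hB z (hsub ⟨hz.1, hz.2.le⟩)).add_const _).hasDerivWithinAt)
    (by
      intro z hz r hr
      obtain ⟨p, p', h1, h2, h3, h4⟩ := hp z (hsub ⟨hz.1, hz.2.le⟩)
      have h5 := (hasDerivAt_iff_tendsto_slope.1 h1).mono_left
        (nhdsWithin_mono z (fun y (hy : z < y) => (ne_of_gt hy : y ≠ z)))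
      have h6 := h5.eventually_lt_const (lt_of_le_of_lt h2 hr)
      refine Eventually.frequently ?_
      filter_upwards [h6, self_mem_nhdsWithin] with y hy hy2
      refine lt_of_le_of_lt ?_ hy
      have hy3 : z < y := hy2
      simp only [slope_def_field]
      rw [h3]
      have := h4 y hy3.le
      have : 0 < y - z := by linarith
      gcongr)
  have := key (right_mem_Icc.2 hac)
  simp only at this ⊢
  linarith

lemma aux_lim (t0 L : ℝ) (f B : ℝ → ℝ) (h : AntitoneOn (fun t => f t - B t) (Ici t0))
    (h0 : ∀ t ∈ Ici t0, 0 ≤ f t) (hB : Tendsto B atTop (nhds L)) (K : ℝ)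
    (hK : ∀ t ∈ Ici t0, B t ≤ K) :
    (∃ l, Tendsto f atTop (nhds l)) ∧ ∃ M, ∀ t ∈ Ici t0, f t ≤ M := by
  constructor
  · have hanti : Antitone (fun t => f (max t t0) - B (max t t0)) := by
      intro a c hac
      exact h (mem_Ici.2 (le_max_right _ _)) (mem_Ici.2 (le_max_right _ _)) (max_le_max_right _ hac)
    have hb : BddBelow (range (fun t => f (max t t0) - B (max t t0))) := by
      refine ⟨-K, ?_⟩
      rintro _ ⟨t, rfl⟩
      have h1 := h0 (max t t0) (mem_Ici.2 (le_max_right _ _))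
      have h2 := hK (max t t0) (mem_Ici.2 (le_max_right _ _))
      simp only
      linarith
    have h1 := tendsto_atTop_ciInf hanti hb
    refine ⟨_, (h1.add hB).congr' ?_⟩
    filter_upwards [eventually_ge_atTop t0] with t ht
    simp [max_eq_left ht]
  · refine ⟨f t0 - B t0 + K, fun t ht => ?_⟩
    have h1 := h (mem_Ici.2 le_rfl) ht ht
    have h2 := hK t ht
    simp only at h1
    linarith

lemma aux_grad_s9 {H : Type*} [NormedAddCommGroup H] [InnerProductSpace ℝ H] [CompleteSpace H]
    (f : H → ℝ) (hf : ConvexOn ℝ univ f) (x y : H) (hd : DifferentiableAt ℝ f x) :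
    f x - f y ≤ inner ℝ (gradient f x) (x - y) := by
  have hconv : ConvexOn ℝ univ (f ∘ AffineMap.lineMap (k := ℝ) x y) := by
    simpa using hf.comp_affineMap (AffineMap.lineMap (k := ℝ) x y)
  have hfd := hd.hasGradientAt.hasFDerivAt
  have hl : HasDerivAt (AffineMap.lineMap (k := ℝ) x y) (y - x) (0 : ℝ) :=
    AffineMap.hasDerivAt_lineMap
  have hc := HasFDerivAt.comp_hasDerivAt_of_eq (0 : ℝ) hfd hl (by simp)
  have := hconv.le_slope_of_hasDerivAt (mem_univ 0) (mem_univ 1) one_pos hc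
  rw [InnerProductSpace.toDual_apply_apply, inner_sub_right] at this
  simp only [slope_def_field, Function.comp_apply, AffineMap.lineMap_apply_one,
    AffineMap.lineMap_apply_zero, sub_zero, div_one] at this
  rw [inner_sub_right]
  linarith

lemma aux_sandwich {H : Type*} [NormedAddCommGroup H] [NormedSpace ℝ H]
    (f h : H → ℝ) (x : H) (h0 : ∀ y, 0 ≤ f y) (hfh : ∀ y, f y ≤ h y) (hx : h x = 0)
    (hd : HasFDerivAt h (0 : H →L[ℝ] ℝ) x) : HasFDerivAt f (0 : H →L[ℝ] ℝ) x := by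
  have hfx : f x = 0 := le_antisymm (hx ▸ hfh x) (h0 x)
  rw [hasFDerivAt_iff_isLittleO] at hd ⊢
  refine Asymptotics.IsBigO.trans_isLittleO ?_ hd
  refine Asymptotics.IsBigO.of_norm_le fun y => ?_
  simp only [hfx, hx, sub_zero, zero_apply, Real.norm_eq_abs]
  rw [abs_of_nonneg (h0 y)]
  exact hfh y

section
variable {H : Type*} (m : ℕ) (g : Fin m → H → ℝ)
    (Q : Set (EuclideanSpace ℝ (Fin m))) (D : EuclideanSpace ℝ (Fin m) → ℝ)

lemma aux_cont (hD : Continuous D) (μ : ℝ) (x : H) :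
    Continuous (fun l : EuclideanSpace ℝ (Fin m) => ∑ i, l i * g i x - μ * D l) := by
  fun_prop

lemma aux_le (hQ : IsCompact Q) (hD : Continuous D) (μ : ℝ) (x : H)
    (l : EuclideanSpace ℝ (Fin m)) (hl : l ∈ Q) :
    ∑ i, l i * g i x - μ * D l ≤ phiMu m g Q D μ x :=
  le_csSup (hQ.image (aux_cont m g D hD μ x)).bddAbove (mem_image_of_mem _ hl)

lemma aux_sup_le (hQne : Q.Nonempty) (μ : ℝ) (x : H) (r : ℝ)
    (h : ∀ l ∈ Q, ∑ i, l i * g i x - μ * D l ≤ r) : phiMu m g Q D μ x ≤ r := by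
  refine csSup_le (hQne.image _) ?_
  rintro _ ⟨l, hl, rfl⟩
  exact h l hl

lemma aux_phi (x : H) : phi m g Q x = phiMu m g Q D 0 x := by
  simp [phi, phiMu]

/-- Comparison of parameters. -/
lemma aux_anti (hQne : Q.Nonempty) (hQ : IsCompact Q) (hD : Continuous D)
    (hD0 : ∀ l ∈ Q, 0 ≤ D l) (μ ν : ℝ) (h : μ ≤ ν) (x : H) :
    phiMu m g Q D ν x ≤ phiMu m g Q D μ x := by
  refine aux_sup_le m g Q D hQne ν x _ fun l hl => ?_
  refine le_trans ?_ (aux_le m g Q D hQ hD μ x l hl)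
  have := mul_le_mul_of_nonneg_right h (hD0 l hl)
  linarith

lemma aux_lip_s9 (hQne : Q.Nonempty) (hQ : IsCompact Q) (hD : Continuous D)
    (C : ℝ) (hC : ∀ l ∈ Q, D l ≤ C) (μ ν : ℝ) (h : μ ≤ ν) (x : H) :
    phiMu m g Q D μ x ≤ phiMu m g Q D ν x + C * (ν - μ) := by
  refine aux_sup_le m g Q D hQne μ x _ fun l hl => ?_
  have h1 := aux_le m g Q D hQ hD ν x l hl
  have := mul_le_mul_of_nonneg_right (hC l hl) (sub_nonneg.2 h)
  nlinarith

lemma aux_conv [NormedAddCommGroup H] [NormedSpace ℝ H] (hQne : Q.Nonempty) (hQ : IsCompact Q)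
    (hD : Continuous D)
    (hQpos : ∀ l ∈ Q, ∀ i, 0 ≤ l i) (hg : ∀ i, ConvexOn ℝ univ (g i)) (μ : ℝ) :
    ConvexOn ℝ univ (phiMu m g Q D μ) := by
  refine ⟨convex_univ, ?_⟩
  intro x _ y _ a b ha hb hab
  refine aux_sup_le m g Q D hQne μ _ _ fun l hl => ?_
  have h1 := mul_le_mul_of_nonneg_left (aux_le m g Q D hQ hD μ x l hl) ha
  have h2 := mul_le_mul_of_nonneg_left (aux_le m g Q D hQ hD μ y l hl) hb
  have h3 : ∑ i, l i * g i (a • x + b • y) ≤ ∑ i, l i * (a * g i x + b * g i y) := by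
    refine Finset.sum_le_sum fun i _ => mul_le_mul_of_nonneg_left ?_ (hQpos l hl i)
    exact (hg i).2 (mem_univ x) (mem_univ y) ha hb hab
  have h4 : ∑ i, l i * (a * g i x + b * g i y)
      = a * ∑ i, l i * g i x + b * ∑ i, l i * g i y := by
    rw [Finset.mul_sum, Finset.mul_sum, ← Finset.sum_add_distrib]
    exact Finset.sum_congr rfl fun i _ => by ring
  have h5 : μ * D l = a * (μ * D l) + b * (μ * D l) := by rw [← add_mul, hab, one_mul]
  simp only [smul_eq_mul]
  linarith

lemma aux_diff [NormedAddCommGroup H] [NormedSpace ℝ H] (hQne : Q.Nonempty) (hQ : IsCompact Q)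
    (hQconv : Convex ℝ Q) (hD : Continuous D) (σ : ℝ) (hσ : 0 < σ) (hDsc : StrongConvexOn Q σ D)
    (hg : ∀ i, Differentiable ℝ (g i)) (μ : ℝ) (hμ : 0 < μ) (x : H) :
    DifferentiableAt ℝ (phiMu m g Q D μ) x := by
  obtain ⟨w, hw, hmax⟩ := hQ.exists_isMaxOn hQne (aux_cont m g D hD μ x).continuousOn
  replace hmax : ∀ l ∈ Q, ∑ i, l i * g i x - μ * D l ≤ ∑ i, w i * g i x - μ * D w := hmax
  set c := μ * σ / 4 with hc
  have hcpos : 0 < c := by positivity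
  have hquad : ∀ l ∈ Q, ∑ i, l i * g i x - μ * D l ≤
      ∑ i, w i * g i x - μ * D w - c * ∑ i, (l i - w i) ^ 2 := by
    intro l hl
    obtain ⟨-, hsc⟩ := id hDsc
    have h1 := hsc hl hw (show (0 : ℝ) ≤ 1/2 by norm_num) (show (0 : ℝ) ≤ 1/2 by norm_num)
      (by norm_num)
    have h2 := hmax _ (hQconv hl hw (a := 1/2) (b := 1/2) (by norm_num) (by norm_num)
      (by norm_num))
    have h3 : ∑ i, ((1/2 : ℝ) • l + (1/2 : ℝ) • w) i * g i x
        = 1/2 * ∑ i, l i * g i x + 1/2 * ∑ i, w i * g i x := by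
      rw [Finset.mul_sum, Finset.mul_sum, ← Finset.sum_add_distrib]
      exact Finset.sum_congr rfl fun i _ => by simp; ring
    have h4 : ‖l - w‖ ^ 2 = ∑ i, (l i - w i) ^ 2 := by
      rw [EuclideanSpace.real_norm_sq_eq]; simp
    simp only [smul_eq_mul] at h1
    rw [h4] at h1
    rw [h3] at h2
    have h5 := mul_le_mul_of_nonneg_left h1 hμ.le
    rw [hc]
    linarith
  have hup : ∀ y, phiMu m g Q D μ y - (∑ i, w i * g i y - μ * D w) ≤
      1 / (4 * c) * ∑ i, (g i y - g i x) ^ 2 := by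
    intro y
    rw [sub_le_iff_le_add]
    refine aux_sup_le m g Q D hQne μ y _ fun l hl => ?_
    have h1 := hquad l hl
    have h2 : ∑ i, (l i - w i) * (g i y - g i x) ≤
        ∑ i, (1 / (4 * c) * (g i y - g i x) ^ 2 + c * (l i - w i) ^ 2) := by
      refine Finset.sum_le_sum fun i _ => ?_
      have : 1 / (4 * c) * (g i y - g i x) ^ 2 + c * (l i - w i) ^ 2
        - (l i - w i) * (g i y - g i x) = c * ((l i - w i) - (g i y - g i x) / (2 * c)) ^ 2 := by
        field_simp
        ring
      have h3 : 0 ≤ c * ((l i - w i) - (g i y - g i x) / (2 * c)) ^ 2 := by positivity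
      linarith
    rw [Finset.sum_add_distrib, ← Finset.mul_sum, ← Finset.mul_sum] at h2
    have h3 : ∑ i, (l i - w i) * (g i y - g i x) = ∑ i, l i * g i y - ∑ i, l i * g i x
        - ∑ i, w i * g i y + ∑ i, w i * g i x := by
      rw [← Finset.sum_sub_distrib, ← Finset.sum_sub_distrib, ← Finset.sum_add_distrib]
      exact Finset.sum_congr rfl fun i _ => by ring
    linarith
  have hder : HasFDerivAt (fun y => 1 / (4 * c) * ∑ i, (g i y - g i x) ^ 2) (0 : H →L[ℝ] ℝ) x := by
    have : HasFDerivAt (fun y => ∑ i, (g i y - g i x) ^ 2)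
        (∑ i : Fin m, (0 : H →L[ℝ] ℝ)) x := by
      refine HasFDerivAt.fun_sum fun i _ => ?_
      have := (((hg i) x).hasFDerivAt.sub_const (g i x)).pow 2
      simpa using this
    simpa using this.const_mul (1 / (4 * c))
  have h := aux_sandwich (fun y => phiMu m g Q D μ y - (∑ i, w i * g i y - μ * D w)) _ x
    (fun y => sub_nonneg.2 (aux_le m g Q D hQ hD μ y w hw)) hup (by simp) hder
  have h2 : DifferentiableAt ℝ (fun y => ∑ i, w i * g i y - μ * D w) x := by fun_prop
  simpa using h.differentiableAt.fun_add h2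

end

theorem statement9 {H : Type*} [NormedAddCommGroup H] [InnerProductSpace ℝ H]
    [CompleteSpace H]
    (m : ℕ) (hm : 1 ≤ m)
    (g : Fin m → H → ℝ) (hg : ∀ i, ConvexOn ℝ Set.univ (g i))
    (hgdiff : ∀ i, Differentiable ℝ (g i))
    -- each `∇ g i` is Lipschitz continuous on every bounded set
    (hgradLip : ∀ i, ∀ s : Set H, Bornology.IsBounded s →
      ∃ Li : ℝ, ∀ x ∈ s, ∀ y ∈ s,
        ‖gradient (g i) x - gradient (g i) y‖ ≤ Li * ‖x - y‖)
    (Q : Set (EuclideanSpace ℝ (Fin m))) (hQne : Q.Nonempty) (hQcomp : IsCompact Q)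
    (hQconv : Convex ℝ Q) (hQpos : ∀ l ∈ Q, ∀ i, 0 ≤ l i)
    (D : EuclideanSpace ℝ (Fin m) → ℝ) (hDcont : Continuous D)
    (hDnonneg : ∀ l ∈ Q, 0 ≤ D l)
    (σ : ℝ) (hσ : 0 < σ) (hDsc : StrongConvexOn Q σ D)
    (hDinf : IsGLB (D '' Q) 0)
    (C : ℝ) (hC : IsLUB (D '' Q) C)
    -- `D` is differentiable on a neighborhood `U` of `Q`
    (U : Set (EuclideanSpace ℝ (Fin m))) (hUopen : IsOpen U) (hQU : Q ⊆ U)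
    (hDdiff : ∀ l ∈ U, DifferentiableAt ℝ D l)
    -- `xstar` is a minimizer of `φ` (so `inf φ = φ xstar`)
    (xstar : H) (hstar : ∀ y : H, phi m g Q xstar ≤ phi m g Q y)
    -- time data
    (t0 α : ℝ) (ht0 : 0 < t0) (hα : 3 ≤ α)
    -- `μ` is continuously differentiable, positive and nonincreasing on `[t0, ∞)`
    (μ μ' : ℝ → ℝ) (hμpos : ∀ t ∈ Set.Ici t0, 0 < μ t)
    (hμderiv : ∀ t ∈ Set.Ici t0, HasDerivAt μ (μ' t) t)
    (hμ'cont : ContinuousOn μ' (Set.Ici t0))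
    (hμanti : AntitoneOn μ (Set.Ici t0))
    -- `x` is a twice continuously differentiable solution of the inertial system
    (x x' x'' : ℝ → H)
    (hx' : ∀ t ∈ Set.Ici t0, HasDerivAt x (x' t) t)
    (hx'' : ∀ t ∈ Set.Ici t0, HasDerivAt x' (x'' t) t)
    (hx''cont : ContinuousOn x'' (Set.Ici t0))
    (hODE : ∀ t ∈ Set.Ici t0,
      x'' t + (α / t) • x' t + gradient (phiMu m g Q D (μ t)) (x t) = 0)
    -- Assumption A
    (hA1 : MeasureTheory.IntegrableOn (fun t => t * μ t) (Set.Ioi t0))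
    (hA2 : MeasureTheory.IntegrableOn (fun t => t ^ 2 * |μ' t|) (Set.Ioi t0))
 :
    (∃ M : ℝ, ∀ t ∈ Set.Ici t0, ‖x t - xstar + (t / (α - 1)) • x' t‖ ≤ M) ∧
    (∃ Elim : ℝ, Filter.Tendsto (fun t : ℝ =>
        (1 / 2) * ‖x t - xstar + (t / (α - 1)) • x' t‖ ^ 2 +
          (t ^ 2 / (α - 1) ^ 2) * (phiMu m g Q D (μ t) (x t) - phi m g Q xstar))
      Filter.atTop (nhds Elim)) ∧
    (∃ K : ℝ, 0 < K ∧ ∀ t ∈ Set.Ici t0,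
      |phiMu m g Q D (μ t) (x t) - phi m g Q xstar| ≤ K / t ^ 2) := by
  have hα1 : 0 < α - 1 := by linarith
  have hC' : ∀ l ∈ Q, D l ≤ C := fun l hl => hC.1 (mem_image_of_mem _ hl)
  have hC0 : 0 ≤ C := by
    obtain ⟨l, hl⟩ := hQne
    exact (hDnonneg l hl).trans (hC' l hl)
  have hdiff : ∀ t ∈ Ici t0, ∀ y, DifferentiableAt ℝ (phiMu m g Q D (μ t)) y := fun t ht y =>
    aux_diff m g Q D hQne hQcomp hQconv hDcont σ hσ hDsc hgdiff (μ t) (hμpos t ht) y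
  have hpos : ∀ t ∈ Ici t0, (0 : ℝ) < t := fun t ht => lt_of_lt_of_le ht0 ht
  set ψ : ℝ → ℝ := fun t => phiMu m g Q D (μ t) (x t) with hψ
  set P := phi m g Q xstar with hP
  set v : ℝ → H := fun t => x t - xstar + (t / (α - 1)) • x' t with hv
  -- lower bound
  have hlow : ∀ t ∈ Ici t0, 0 ≤ ψ t + C * μ t - P := by
    intro t ht
    have h1 := aux_lip_s9 m g Q D hQne hQcomp hDcont C hC' 0 (μ t) (hμpos t ht).le (x t)
    rw [← aux_phi m g Q D] at h1
    have h2 := hstar (x t)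
    simp only [hψ]
    linarith
  -- the integral
  let q : ℝ → ℝ := fun s => max s t0 * μ (max s t0)
  have hqc : Continuous q := by
    have h1 : Continuous (fun s => μ (max s t0)) := by
      have h2 : ContinuousOn μ (Ici t0) := fun t ht => (hμderiv t ht).continuousAt.continuousWithinAt
      exact h2.comp_continuous (by fun_prop) (fun s => mem_Ici.2 (le_max_right _ _))
    exact (by fun_prop : Continuous fun s : ℝ => max s t0).mul h1
  have hqe : ∀ t ∈ Ici t0, q t = t * μ t := fun t ht => by
    simp only [q]; rw [max_eq_left ht]
  have hq0 : ∀ t, 0 ≤ q t := fun t =>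
    mul_nonneg (hpos _ (mem_Ici.2 (le_max_right _ _))).le (hμpos _ (mem_Ici.2 (le_max_right _ _))).le
  let I : ℝ → ℝ := fun t => ∫ s in t0..t, q s
  have hI' : ∀ t, HasDerivAt I (q t) t := fun t =>
    intervalIntegral.integral_hasDerivAt_right (hqc.intervalIntegrable _ _)
      (hqc.stronglyMeasurableAtFilter _ _) hqc.continuousAt
  have hqint : IntegrableOn q (Ioi t0) :=
    hA1.congr_fun (fun t ht => (hqe t (mem_Ici.2 (le_of_lt ht))).symm) measurableSet_Ioi
  have hIlim : Tendsto I atTop (nhds (∫ s in Ioi t0, q s)) :=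
    intervalIntegral_tendsto_integral_Ioi t0 hqint tendsto_id
  have hImono : Monotone I := monotone_of_hasDerivAt_nonneg hI' hq0
  have hIle : ∀ t, I t ≤ ∫ s in Ioi t0, q s := fun t => hImono.ge_of_tendsto hIlim t
  -- `t ^ 2 * μ t`
  have hμc : ContinuousOn μ (Ici t0) := fun t ht => (hμderiv t ht).continuousAt.continuousWithinAt
  obtain ⟨⟨l1, hl1⟩, M1, hM1⟩ := aux_lim t0 _ (fun t => t ^ 2 * μ t) (fun t => 2 * I t)
    (aux_antitone t0 _ _ (fun t => 2 * q t) (by fun_prop) (fun t _ => (hI' t).const_mul 2) (by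
      intro t ht
      refine ⟨fun s => s ^ 2 * μ t, 2 * t * μ t, ?_, ?_, rfl, ?_⟩
      · simpa using (hasDerivAt_pow 2 t).mul_const (μ t)
      · rw [hqe t ht]; linarith
      · intro s hs
        exact mul_le_mul_of_nonneg_left (hμanti ht (le_trans ht hs) hs) (sq_nonneg s)))
    (fun t ht => mul_nonneg (sq_nonneg t) (hμpos t ht).le) (hIlim.const_mul 2) _
    (fun t _ => mul_le_mul_of_nonneg_left (hIle t) zero_le_two)
  -- continuity of `ψ`
  have hxcomp : ∀ t ∈ Ici t0, HasDerivAt (fun s => phiMu m g Q D (μ t) (x s))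
      (inner ℝ (gradient (phiMu m g Q D (μ t)) (x t)) (x' t)) t := by
    intro t ht
    have h1 := (hdiff t ht (x t)).hasGradientAt.hasFDerivAt
    have h2 := HasFDerivAt.comp_hasDerivAt t h1 (hx' t ht)
    exact h2
  have hψc : ContinuousOn ψ (Ici t0) := by
    intro t ht
    have h1 : Tendsto (fun s => phiMu m g Q D (μ t) (x s)) (nhdsWithin t (Ici t0)) (nhds (ψ t)) :=
      (hxcomp t ht).continuousAt.continuousWithinAt
    have h2 : Tendsto (fun s => C * |μ s - μ t|) (nhdsWithin t (Ici t0)) (nhds 0) := by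
      have h3 : ContinuousWithinAt (fun s => C * |μ s - μ t|) (Ici t0) t :=
        continuousWithinAt_const.mul ((hμc t ht).sub continuousWithinAt_const).abs
      simpa [ContinuousWithinAt] using h3
    have hb : ∀ s, |ψ s - phiMu m g Q D (μ t) (x s)| ≤ C * |μ s - μ t| := by
      intro s
      simp only [hψ]
      rcases le_total (μ s) (μ t) with h | h
      · have e1 := aux_lip_s9 m g Q D hQne hQcomp hDcont C hC' _ _ h (x s)
        have e2 := aux_anti m g Q D hQne hQcomp hDcont hDnonneg _ _ h (x s)
        rw [abs_of_nonneg (by linarith), abs_of_nonpos (by linarith)]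
        linarith
      · have e1 := aux_lip_s9 m g Q D hQne hQcomp hDcont C hC' _ _ h (x s)
        have e2 := aux_anti m g Q D hQne hQcomp hDcont hDnonneg _ _ h (x s)
        rw [abs_of_nonpos (by linarith), abs_of_nonneg (by linarith)]
        linarith
    have h4 := squeeze_zero_norm (f := fun s => ψ s - phiMu m g Q D (μ t) (x s)) hb h2
    have h5 := h4.add h1
    simpa [ContinuousWithinAt] using h5
  have hv' : ∀ t ∈ Ici t0, HasDerivAt v
      (-(t / (α - 1)) • gradient (phiMu m g Q D (μ t)) (x t)) t := by
    intro t ht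
    have h1 := ((hx' t ht).sub_const xstar).add
      (((hasDerivAt_id t).div_const (α - 1)).smul (hx'' t ht))
    refine HasDerivAt.congr_deriv (f := v) h1 ?_
    have h2 : gradient (phiMu m g Q D (μ t)) (x t) = -(x'' t + (α / t) • x' t) :=
      (neg_eq_of_add_eq_zero_right (hODE t ht)).symm
    rw [h2]
    have htp := hpos t ht
    simp only [id, smul_neg, neg_smul, neg_neg, smul_add, smul_smul]
    have h3 : t / (α - 1) * (α / t) = 1 + 1 / (α - 1) := by field_simp; ring
    rw [neg_mul, h3]
    module
  have hvc : ContinuousOn v (Ici t0) := fun t ht => (hv' t ht).continuousAt.continuousWithinAt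
  -- Lyapunov function
  obtain ⟨⟨l2, hl2⟩, M2, hM2⟩ := aux_lim t0 _
    (fun t => (1 / 2) * ‖v t‖ ^ 2 + (t ^ 2 / (α - 1) ^ 2) * (ψ t + C * μ t - P))
    (fun t => C / (α - 1) * I t)
    (aux_antitone t0 _ _ (fun t => C / (α - 1) * q t) (by fun_prop)
      (fun t _ => (hI' t).const_mul _) (by
      intro t ht
      have htp := hpos t ht
      set G := gradient (phiMu m g Q D (μ t)) (x t) with hG
      refine ⟨fun s => (1 / 2) * ‖v s‖ ^ 2 +
        (s ^ 2 / (α - 1) ^ 2) * (phiMu m g Q D (μ t) (x s) + C * μ t - P), _,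
        (((hv' t ht).norm_sq).const_mul (1 / 2)).add
          ((((hasDerivAt_pow 2 t).div_const _)).mul
            (((hxcomp t ht).add_const (C * μ t)).sub_const P)), ?_, rfl, ?_⟩
      · have h1 : ψ t - P ≤ inner ℝ G (x t - xstar) := by
          have e1 := aux_grad_s9 _ (aux_conv m g Q D hQne hQcomp hDcont hQpos hg (μ t)) (x t) xstar
            (hdiff t ht (x t))
          have e2 := aux_anti m g Q D hQne hQcomp hDcont hDnonneg 0 (μ t) (hμpos t ht).le xstar
          rw [← aux_phi m g Q D] at e2
          simp only [hψ]
          linarith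
        have h2 := hlow t ht
        have h3 : inner ℝ (v t) (-(t / (α - 1)) • G) = -(t / (α - 1)) * inner ℝ G (x t - xstar)
            - (t / (α - 1)) ^ 2 * inner ℝ G (x' t) := by
          simp only [hv]
          rw [inner_smul_right, real_inner_comm, inner_add_right, inner_smul_right]
          ring
        simp only [← hG]
        rw [h3, hqe t ht]
        change _ * (2 * _) + (_ * (ψ t + C * μ t - P) + _) ≤ _
        have h4 : 0 ≤ t / (α - 1) := by positivity
        have h5 := mul_le_mul_of_nonneg_left h1 h4
        have h6 : 0 ≤ t * (α - 3) / (α - 1) ^ 2 * (ψ t + C * μ t - P) :=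
          mul_nonneg (div_nonneg (mul_nonneg htp.le (by linarith)) (sq_nonneg _)) h2
        have h7 : t * (α - 3) / (α - 1) ^ 2 = t / (α - 1) - 2 * t / (α - 1) ^ 2 := by
          field_simp; ring
        rw [h7] at h6
        push_cast
        have h8 : t ^ 2 / (α - 1) ^ 2 = (t / (α - 1)) ^ 2 := by rw [div_pow]
        have h9 : C / (α - 1) * (t * μ t) = t / (α - 1) * (C * μ t) := by ring
        rw [h8, h9]
        simp only [Nat.reduceSub, pow_one]
        linarith
      · intro s hs
        have e1 := aux_lip_s9 m g Q D hQne hQcomp hDcont C hC' _ _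
          (hμanti ht (le_trans ht hs) hs) (x s)
        have : (0 : ℝ) ≤ s ^ 2 / (α - 1) ^ 2 := by positivity
        have e2 : ψ s + C * μ s - P ≤ phiMu m g Q D (μ t) (x s) + C * μ t - P := by
          simp only [hψ]; linarith
        have := mul_le_mul_of_nonneg_left e2 this
        simp only
        linarith))
    (fun t ht => add_nonneg (by positivity) (mul_nonneg (by positivity) (hlow t ht)))
    (hIlim.const_mul _) _
    (fun t _ => mul_le_mul_of_nonneg_left (hIle t) (by positivity))
  have hM20 : 0 ≤ M2 := le_trans (add_nonneg (by positivity)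
    (mul_nonneg (by positivity) (hlow t0 (mem_Ici.2 le_rfl)))) (hM2 t0 (mem_Ici.2 le_rfl))
  refine ⟨⟨2 * M2 + 1, fun t ht => ?_⟩, ⟨l2 - C / (α - 1) ^ 2 * l1, ?_⟩,
    ⟨(α - 1) ^ 2 * M2 + C * M1 + 1, ?_, fun t ht => ?_⟩⟩
  · have h1 := hM2 t ht
    have h2 : 0 ≤ t ^ 2 / (α - 1) ^ 2 * (ψ t + C * μ t - P) :=
      mul_nonneg (by positivity) (hlow t ht)
    change ‖v t‖ ≤ _
    nlinarith [sq_nonneg (‖v t‖ - 1)]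
  · refine (hl2.sub (hl1.const_mul (C / (α - 1) ^ 2))).congr fun t => ?_
    simp only [hψ, hv]
    ring
  · have h1 := hM1 t0 (mem_Ici.2 le_rfl)
    have h2 : 0 ≤ t0 ^ 2 * μ t0 := mul_nonneg (sq_nonneg _) (hμpos t0 (mem_Ici.2 le_rfl)).le
    have h3 : 0 ≤ M1 := le_trans h2 h1
    positivity
  · have htp := hpos t ht
    have h1 := hM2 t ht
    have h2 := hM1 t ht
    have h3 := hlow t ht
    have hμt := hμpos t ht
    have h4 : t ^ 2 / (α - 1) ^ 2 * (ψ t + C * μ t - P) ≤ M2 := by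
      have : 0 ≤ 1 / 2 * ‖v t‖ ^ 2 := by positivity
      linarith
    have h5 : t ^ 2 * (ψ t + C * μ t - P) ≤ (α - 1) ^ 2 * M2 := by
      rw [div_mul_eq_mul_div, div_le_iff₀ (by positivity)] at h4
      linarith
    have h6 := mul_le_mul_of_nonneg_left h2 hC0
    have h7 : 0 ≤ t ^ 2 * (ψ t + C * μ t - P) := by positivity
    have h8 : 0 ≤ C * (t ^ 2 * μ t) := by positivity
    have h9 : 0 ≤ (α - 1) ^ 2 * M2 := by positivity
    change |ψ t - P| ≤ _
    rw [le_div_iff₀ (by positivity), ← abs_of_pos (show 0 < t ^ 2 by positivity), ← abs_mul,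
      abs_le]
    constructor <;> nlinarith
end

section
/- Under Assumption A, if α > 3 then t ↦ t·|φ_{μ(t)}(x(t)) − inf φ| is Lebesgue integrable on (t0,∞), i.e. ∫_{t0}^∞ t |φ_{μ(t)}(x(t)) − inf φ| dt < ∞. -/
open scoped BigOperators
open Set Filter MeasureTheory

lemma support_hasFDerivAt {X : Type*} [NormedAddCommGroup X] [NormedSpace ℝ X]
    (K : Set (X →L[ℝ] ℝ)) (hK : IsCompact K) (l0 : X →L[ℝ] ℝ) (hl0 : l0 ∈ K) (u0 : X)
    (huniq : ∀ l ∈ K, l ≠ l0 → l u0 < l0 u0) :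
    HasFDerivAt (fun u => sSup ((fun l : X →L[ℝ] ℝ => l u) '' K)) l0 u0 := by
  have hcont : ∀ u : X, Continuous (fun l : X →L[ℝ] ℝ => l u) := fun u => by fun_prop
  have hbdd : ∀ u : X, BddAbove ((fun l : X →L[ℝ] ℝ => l u) '' K) :=
    fun u => (hK.image (hcont u)).bddAbove
  have hatt : ∀ u : X, ∃ l ∈ K, sSup ((fun l : X →L[ℝ] ℝ => l u) '' K) = l u := by
    intro u
    obtain ⟨l, hl, h⟩ := (hK.image (hcont u)).sSup_mem (Set.Nonempty.image _ ⟨l0, hl0⟩)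
    exact ⟨l, hl, h.symm⟩
  have hle : ∀ u : X, ∀ l ∈ K, l u ≤ sSup ((fun l : X →L[ℝ] ℝ => l u) '' K) :=
    fun u l hl => le_csSup (hbdd u) ⟨l, hl, rfl⟩
  have h0 : sSup ((fun l : X →L[ℝ] ℝ => l u0) '' K) = l0 u0 := by
    obtain ⟨l, hl, h⟩ := hatt u0
    by_cases e : l = l0
    · rw [h, e]
    · exact absurd (hle u0 l0 hl0) (by rw [h]; exact not_le.2 (huniq l hl e))
  obtain ⟨M, hM⟩ := hK.isBounded.exists_norm_le
  rw [hasFDerivAt_iff_isLittleO, Asymptotics.isLittleO_iff]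
  intro ε hε
  -- the gap
  have hgap : ∃ δ > 0, ∀ l ∈ K, ε ≤ ‖l - l0‖ → l u0 + δ ≤ l0 u0 := by
    have hK' : IsCompact (K ∩ {l | ε ≤ ‖l - l0‖}) :=
      hK.inter_right (isClosed_le continuous_const (by fun_prop))
    rcases (K ∩ {l | ε ≤ ‖l - l0‖}).eq_empty_or_nonempty with he | hne
    · refine ⟨1, one_pos, fun l hl h => ?_⟩
      have : l ∈ K ∩ {l | ε ≤ ‖l - l0‖} := ⟨hl, h⟩
      rw [he] at this
      exact this.elim
    · obtain ⟨l1, hl1, hmax⟩ := hK'.exists_isMaxOn hne (hcont u0).continuousOn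
      have : l1 u0 < l0 u0 := by
        refine huniq l1 hl1.1 ?_
        rintro rfl
        have := hl1.2
        simp at this
        linarith
      refine ⟨l0 u0 - l1 u0, by linarith, fun l hl h => ?_⟩
      have := hmax (show l ∈ K ∩ {l | ε ≤ ‖l - l0‖} from ⟨hl, h⟩)
      simp only [mem_ofPred_eq] at this
      linarith
  obtain ⟨δ, hδ, hgap⟩ := hgap
  have hM0 : 0 ≤ M := (norm_nonneg _).trans (hM l0 hl0)
  have hnear : ∀ᶠ u in nhds u0, ‖u - u0‖ < δ / (2 * M + 1) := by
    have : Continuous (fun u => ‖u - u0‖) := by fun_prop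
    refine this.continuousAt.eventually_lt continuousAt_const ?_
    simp only [sub_self, norm_zero]
    positivity
  filter_upwards [hnear] with u hu
  rw [lt_div_iff₀ (by positivity)] at hu
  obtain ⟨l, hl, h⟩ := hatt u
  have e1 := hle u l0 hl0
  have e2 := hle u0 l hl
  have e0 : l0 (u - u0) = l0 u - l0 u0 := map_sub _ _ _
  have e0' : l (u - u0) = l u - l u0 := map_sub _ _ _
  have b1 : ‖l (u - u0)‖ ≤ M * ‖u - u0‖ := l.le_of_opNorm_le (hM l hl) _
  have b2 : ‖l0 (u - u0)‖ ≤ M * ‖u - u0‖ := l0.le_of_opNorm_le (hM l0 hl0) _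
  rw [Real.norm_eq_abs, abs_le] at b1 b2
  have hclose : ‖l - l0‖ < ε := by
    by_contra hc
    have := hgap l hl (not_lt.1 hc)
    rw [h] at e1
    have := norm_nonneg (u - u0)
    nlinarith
  have b3 : ‖(l - l0) (u - u0)‖ ≤ ε * ‖u - u0‖ := (l - l0).le_of_opNorm_le hclose.le _
  rw [Real.norm_eq_abs, abs_le, sub_apply] at b3
  rw [h] at e1
  rw [h0] at e2
  rw [h0, h, Real.norm_eq_abs, abs_le]
  constructor <;> nlinarith [norm_nonneg (u - u0)]

/-- the linear functional attached to `l`. -/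
noncomputable def Lfun {m : ℕ} (D : EuclideanSpace ℝ (Fin m) → ℝ)
    (l : EuclideanSpace ℝ (Fin m)) : ((Fin m → ℝ) × ℝ) →L[ℝ] ℝ :=
  (∑ i, l i • (ContinuousLinearMap.proj (R := ℝ) (φ := fun _ : Fin m => ℝ) i).comp
    (ContinuousLinearMap.fst ℝ (Fin m → ℝ) ℝ)) - D l • ContinuousLinearMap.snd ℝ (Fin m → ℝ) ℝ

lemma Lfun_apply {m : ℕ} (D : EuclideanSpace ℝ (Fin m) → ℝ)
    (l : EuclideanSpace ℝ (Fin m)) (p : (Fin m → ℝ) × ℝ) :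
    Lfun D l p = ∑ i, l i * p.1 i - p.2 * D l := by
  simp [Lfun, mul_comm]

lemma Lfun_cont {m : ℕ} (D : EuclideanSpace ℝ (Fin m) → ℝ) (hD : Continuous D) :
    Continuous (Lfun D) := by
  unfold Lfun
  fun_prop

lemma phiMu_eq {H : Type*} (m : ℕ) (g : Fin m → H → ℝ)
    (Q : Set (EuclideanSpace ℝ (Fin m))) (D : EuclideanSpace ℝ (Fin m) → ℝ) (s : ℝ) (y : H) :
    phiMu m g Q D s y = (fun u => sSup ((fun l : ((Fin m → ℝ) × ℝ) →L[ℝ] ℝ => l u) '' (Lfun D '' Q)))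
      ((fun i => g i y), s) := by
  simp only [phiMu, image_image, Lfun_apply]

lemma exists_max {m : ℕ} (Q : Set (EuclideanSpace ℝ (Fin m))) (hQne : Q.Nonempty)
    (hQcomp : IsCompact Q)
    (D : EuclideanSpace ℝ (Fin m) → ℝ) (hDcont : Continuous D)
    (σ : ℝ) (hσ : 0 < σ) (hDsc : StrongConvexOn Q σ D) (v : Fin m → ℝ) (s : ℝ) (hs : 0 < s) :
    ∃ l ∈ Q, (∀ k ∈ Q, ∑ i, k i * v i - s * D k ≤ ∑ i, l i * v i - s * D l) ∧
      HasFDerivAt (fun u => sSup ((fun l : ((Fin m → ℝ) × ℝ) →L[ℝ] ℝ => l u) '' (Lfun D '' Q)))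
        (Lfun D l) (v, s) := by
  have hc : Continuous (fun k : EuclideanSpace ℝ (Fin m) => ∑ i, k i * v i - s * D k) := by
    fun_prop
  obtain ⟨l, hl, hmax⟩ := hQcomp.exists_isMaxOn hQne hc.continuousOn
  refine ⟨l, hl, fun k hk => hmax hk, ?_⟩
  refine support_hasFDerivAt _ (hQcomp.image (Lfun_cont D hDcont)) _ ⟨l, hl, rfl⟩ _ ?_
  rintro _ ⟨k, hk, rfl⟩ hne
  have hkl : k ≠ l := fun h => hne (by rw [h])
  simp only [Lfun_apply]
  by_contra hcon
  have hkm : ∑ i, k i * v i - s * D k = ∑ i, l i * v i - s * D l :=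
    le_antisymm (hmax hk) (not_lt.1 hcon)
  have hsc := (hDsc.strictConvexOn hσ)
  have hst := hsc.2 hk hl hkl (show (0:ℝ) < 1/2 by norm_num) (show (0:ℝ) < 1/2 by norm_num) (by norm_num)
  have hmem := hsc.1 hk hl (show (0:ℝ) ≤ 1/2 by norm_num) (show (0:ℝ) ≤ 1/2 by norm_num) (by norm_num)
  have := hmax hmem
  have e : ∑ i, ((1/2 : ℝ) • k + (1/2 : ℝ) • l : EuclideanSpace ℝ (Fin m)) i * v i
      = (1/2) * ∑ i, k i * v i + (1/2) * ∑ i, l i * v i := by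
    simp only [Finset.mul_sum, ← Finset.sum_add_distrib]
    refine Finset.sum_congr rfl fun i _ => ?_
    simp only [PiLp.add_apply, PiLp.smul_apply, smul_eq_mul]
    ring
  simp only [mem_ofPred_eq] at this
  rw [e] at this
  simp only [smul_eq_mul] at hst
  nlinarith [mul_lt_mul_of_pos_left hst hs]

lemma convex_grad {H : Type*} [NormedAddCommGroup H] [InnerProductSpace ℝ H]
    (f : H → ℝ) (hf : ConvexOn ℝ Set.univ f) (hd : Differentiable ℝ f) (y z : H) :
    f y - f z ≤ fderiv ℝ f y (y - z) := by
  have h1 : ConvexOn ℝ Set.univ (f ∘ (AffineMap.lineMap (k := ℝ) z y)) := by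
    simpa using hf.comp_affineMap (AffineMap.lineMap (k := ℝ) z y)
  have h2 : HasDerivAt (f ∘ (AffineMap.lineMap (k := ℝ) z y)) (fderiv ℝ f y (y - z)) 1 := by
    have a : HasFDerivAt f (fderiv ℝ f y) (AffineMap.lineMap (k := ℝ) z y (1 : ℝ)) := by
      rw [AffineMap.lineMap_apply_one]; exact (hd y).hasFDerivAt
    exact a.comp_hasDerivAt (1 : ℝ) AffineMap.hasDerivAt_lineMap
  have := h1.slope_le_of_hasDerivAt (mem_univ 0) (mem_univ 1) zero_lt_one h2
  simpa [slope] using this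

/-- final real-variable argument -/
lemma final_step (t0 α C : ℝ) (ht0 : 0 < t0) (hα : 3 < α) (E E' W μ : ℝ → ℝ)
    (hE : ∀ t ∈ Ici t0, HasDerivAt E (E' t) t) (hEnn : ∀ t ∈ Ici t0, 0 ≤ E t)
    (hW : ContinuousOn W (Ici t0)) (hWnn : ∀ t ∈ Ici t0, 0 ≤ W t)
    (hC : 0 ≤ C) (hμ : ∀ t ∈ Ici t0, 0 ≤ μ t)
    (hint : IntegrableOn (fun t => t * μ t) (Ioi t0))
    (hle : ∀ t ∈ Ioi t0, E' t ≤ (3 - α) * (t * W t) + (α - 1) * C * (t * μ t)) :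
    IntegrableOn (fun t => t * W t) (Ioi t0) := by
  have hcW : ContinuousOn (fun t => t * W t) (Ici t0) := continuousOn_id.mul hW
  have hIcc : ∀ T, IntegrableOn (fun t => t * W t) (Icc t0 T) := fun T =>
    (hcW.mono Icc_subset_Ici_self).integrableOn_Icc
  have hIμ : ∀ T, IntegrableOn (fun t => t * μ t) (Icc t0 T) := fun T => by
    rw [integrableOn_Icc_iff_integrableOn_Ioc]
    exact hint.mono_set Ioc_subset_Ioi_self
  refine integrableOn_Ioi_of_intervalIntegral_norm_bounded (l := atTop) (b := id)
    ((E t0 + (α - 1) * C * ∫ t in Ioi t0, t * μ t) / (α - 3)) t0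
    (fun T => (hIcc T).mono_set Ioc_subset_Icc_self) tendsto_id ?_
  filter_upwards [eventually_ge_atTop t0] with T hT
  simp only [id]
  have h1 := intervalIntegral.sub_le_integral_of_hasDeriv_right_of_le hT
    (fun t ht => (hE t ht.1).continuousAt.continuousWithinAt)
    (fun t ht => (hE t ht.1.le).hasDerivWithinAt)
    (((hIcc T).const_mul (3 - α)).add ((hIμ T).const_mul ((α - 1) * C)))
    (fun t ht => hle t ht.1)
  have hi1 : IntervalIntegrable (fun t => t * W t) volume t0 T :=
    (intervalIntegrable_iff_integrableOn_Icc_of_le hT).2 (hIcc T)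
  have hi2 : IntervalIntegrable (fun t => t * μ t) volume t0 T :=
    (intervalIntegrable_iff_integrableOn_Icc_of_le hT).2 (hIμ T)
  have e : ∫ t in t0..T, ((fun x => (3 - α) * (x * W x)) + fun x => (α - 1) * C * (x * μ x)) t
      = (3 - α) * (∫ t in t0..T, t * W t) + (α - 1) * C * ∫ t in t0..T, t * μ t := by
    simp only [Pi.add_apply]
    rw [intervalIntegral.integral_add (hi1.const_mul _) (hi2.const_mul _),
      intervalIntegral.integral_const_mul, intervalIntegral.integral_const_mul]
  rw [e] at h1
  have hμle : ∫ t in t0..T, t * μ t ≤ ∫ t in Ioi t0, t * μ t := by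
    rw [intervalIntegral.integral_of_le hT]
    refine setIntegral_mono_set hint ?_ (Ioc_subset_Ioi_self.eventuallyLE)
    filter_upwards [ae_restrict_mem measurableSet_Ioi] with t ht
    exact mul_nonneg (ht0.trans ht).le (hμ t (Ioi_subset_Ici_self ht))
  have hn : ∫ t in t0..T, ‖t * W t‖ = ∫ t in t0..T, t * W t := by
    refine intervalIntegral.integral_congr fun t ht => ?_
    rw [uIcc_of_le hT] at ht
    exact Real.norm_of_nonneg (mul_nonneg (ht0.trans_le ht.1).le (hWnn t ht.1))
  rw [hn, le_div_iff₀ (by linarith)]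
  have := hEnn T hT
  have := mul_le_mul_of_nonneg_left hμle (mul_nonneg (by linarith : 0 ≤ α - 1) hC)
  nlinarith

theorem statement10 {H : Type*} [NormedAddCommGroup H] [InnerProductSpace ℝ H]
    [CompleteSpace H]
    (m : ℕ) (hm : 1 ≤ m)
    (g : Fin m → H → ℝ) (hg : ∀ i, ConvexOn ℝ Set.univ (g i))
    (hgdiff : ∀ i, Differentiable ℝ (g i))
    -- each `∇ g i` is Lipschitz continuous on every bounded set
    (hgradLip : ∀ i, ∀ s : Set H, Bornology.IsBounded s →
      ∃ Li : ℝ, ∀ x ∈ s, ∀ y ∈ s,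
        ‖gradient (g i) x - gradient (g i) y‖ ≤ Li * ‖x - y‖)
    (Q : Set (EuclideanSpace ℝ (Fin m))) (hQne : Q.Nonempty) (hQcomp : IsCompact Q)
    (hQconv : Convex ℝ Q) (hQpos : ∀ l ∈ Q, ∀ i, 0 ≤ l i)
    (D : EuclideanSpace ℝ (Fin m) → ℝ) (hDcont : Continuous D)
    (hDnonneg : ∀ l ∈ Q, 0 ≤ D l)
    (σ : ℝ) (hσ : 0 < σ) (hDsc : StrongConvexOn Q σ D)
    (hDinf : IsGLB (D '' Q) 0)
    (C : ℝ) (hC : IsLUB (D '' Q) C)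
    -- `D` is differentiable on a neighborhood `U` of `Q`
    (U : Set (EuclideanSpace ℝ (Fin m))) (hUopen : IsOpen U) (hQU : Q ⊆ U)
    (hDdiff : ∀ l ∈ U, DifferentiableAt ℝ D l)
    -- `xstar` is a minimizer of `φ` (so `inf φ = φ xstar`)
    (xstar : H) (hstar : ∀ y : H, phi m g Q xstar ≤ phi m g Q y)
    -- time data
    (t0 α : ℝ) (ht0 : 0 < t0) (hα : 3 < α)
    -- `μ` is continuously differentiable, positive and nonincreasing on `[t0, ∞)`
    (μ μ' : ℝ → ℝ) (hμpos : ∀ t ∈ Set.Ici t0, 0 < μ t)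
    (hμderiv : ∀ t ∈ Set.Ici t0, HasDerivAt μ (μ' t) t)
    (hμ'cont : ContinuousOn μ' (Set.Ici t0))
    (hμanti : AntitoneOn μ (Set.Ici t0))
    -- `x` is a twice continuously differentiable solution of the inertial system
    (x x' x'' : ℝ → H)
    (hx' : ∀ t ∈ Set.Ici t0, HasDerivAt x (x' t) t)
    (hx'' : ∀ t ∈ Set.Ici t0, HasDerivAt x' (x'' t) t)
    (hx''cont : ContinuousOn x'' (Set.Ici t0))
    (hODE : ∀ t ∈ Set.Ici t0,
      x'' t + (α / t) • x' t + gradient (phiMu m g Q D (μ t)) (x t) = 0)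
    -- Assumption A
    (hA1 : MeasureTheory.IntegrableOn (fun t => t * μ t) (Set.Ioi t0))
    (hA2 : MeasureTheory.IntegrableOn (fun t => t ^ 2 * |μ' t|) (Set.Ioi t0))
 :
    MeasureTheory.IntegrableOn
      (fun t => t * |phiMu m g Q D (μ t) (x t) - phi m g Q xstar|)
      (Set.Ioi t0) := by
  set G : ((Fin m → ℝ) × ℝ) → ℝ :=
    fun u => sSup ((fun l : ((Fin m → ℝ) × ℝ) →L[ℝ] ℝ => l u) '' (Lfun D '' Q)) with hG
  have key := fun v s hs => exists_max Q hQne hQcomp D hDcont σ hσ hDsc v s hs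
  have hbd : ∀ (y : H) (s : ℝ),
      BddAbove ((fun l : EuclideanSpace ℝ (Fin m) => ∑ i, l i * g i y - s * D l) '' Q) := by
    intro y s
    exact (hQcomp.image (by fun_prop)).bddAbove
  have hbd0 : ∀ (y : H),
      BddAbove ((fun l : EuclideanSpace ℝ (Fin m) => ∑ i, l i * g i y) '' Q) := by
    intro y
    exact (hQcomp.image (by fun_prop)).bddAbove
  have hCD : ∀ l ∈ Q, D l ≤ C := fun l hl => hC.1 ⟨l, hl, rfl⟩
  have hC0 : 0 ≤ C := by
    obtain ⟨l, hl⟩ := hQne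
    exact (hDnonneg l hl).trans (hCD l hl)
  have hle1 : ∀ y s, 0 < s → phiMu m g Q D s y ≤ phi m g Q y := by
    intro y s hs
    refine csSup_le (hQne.image _) ?_
    rintro _ ⟨l, hl, rfl⟩
    have h1 : ∑ i, l i * g i y ≤ phi m g Q y := le_csSup (hbd0 y) ⟨l, hl, rfl⟩
    have := mul_nonneg hs.le (hDnonneg l hl)
    simp only
    linarith
  have hle2 : ∀ y s, 0 < s → phi m g Q y ≤ phiMu m g Q D s y + C * s := by
    intro y s hs
    refine csSup_le (hQne.image _) ?_
    rintro _ ⟨l, hl, rfl⟩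
    have h1 : ∑ i, l i * g i y - s * D l ≤ phiMu m g Q D s y := le_csSup (hbd y s) ⟨l, hl, rfl⟩
    have := mul_le_mul_of_nonneg_left (hCD l hl) hs.le
    simp only
    linarith
  -- the pointwise differential information
  have hpt : ∀ t ∈ Ici t0, ∃ d : ℝ, 0 ≤ d ∧ d ≤ C ∧
      HasDerivAt (fun t => phiMu m g Q D (μ t) (x t))
        (inner ℝ (gradient (phiMu m g Q D (μ t)) (x t)) (x' t) - μ' t * d) t ∧
      phiMu m g Q D (μ t) (x t) - phiMu m g Q D (μ t) xstar ≤
        inner ℝ (gradient (phiMu m g Q D (μ t)) (x t)) (x t - xstar) := by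
    intro t ht
    obtain ⟨l, hl, hmax, hder⟩ := key (fun i => g i (x t)) (μ t) (hμpos t ht)
    have hgx : HasFDerivAt (fun y => ((fun i => g i y), μ t) : H → (Fin m → ℝ) × ℝ)
        ((ContinuousLinearMap.pi fun i => fderiv ℝ (g i) (x t)).prod 0) (x t) :=
      (hasFDerivAt_pi.2 fun i => (hgdiff i (x t)).hasFDerivAt).prodMk (hasFDerivAt_const _ _)
    have hF : HasFDerivAt (phiMu m g Q D (μ t)) ((Lfun D l).comp
        ((ContinuousLinearMap.pi fun i => fderiv ℝ (g i) (x t)).prod 0)) (x t) := by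
      have : phiMu m g Q D (μ t) = G ∘ (fun y => ((fun i => g i y), μ t)) := by
        funext y; exact phiMu_eq m g Q D (μ t) y
      rw [this]
      exact HasFDerivAt.comp (x t) hder hgx
    have hin : ∀ v, inner ℝ (gradient (phiMu m g Q D (μ t)) (x t)) v
        = ∑ i, l i * fderiv ℝ (g i) (x t) v := by
      intro v
      rw [gradient, InnerProductSpace.toDual_symm_apply, hF.fderiv]
      simp [Lfun_apply]
    refine ⟨D l, hDnonneg l hl, hCD l hl, ?_, ?_⟩
    · have hp : HasDerivAt (fun s => ((fun i => g i (x s)), μ s) : ℝ → (Fin m → ℝ) × ℝ)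
          ((fun i => fderiv ℝ (g i) (x t) (x' t)), μ' t) t := by
        refine HasDerivAt.prodMk (hasDerivAt_pi.2 fun i => ?_) (hμderiv t ht)
        exact (hgdiff i (x t)).hasFDerivAt.comp_hasDerivAt t (hx' t ht)
      have h := HasFDerivAt.comp_hasDerivAt t hder hp
      rw [Lfun_apply] at h
      rw [hin]
      have : (fun t => phiMu m g Q D (μ t) (x t)) = G ∘ fun s => ((fun i => g i (x s)), μ s) := by
        funext s; exact phiMu_eq m g Q D (μ s) (x s)
      rw [this]
      exact h
    · rw [hin]
      have h1 : phiMu m g Q D (μ t) (x t) ≤ ∑ i, l i * g i (x t) - μ t * D l := by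
        refine csSup_le (hQne.image _) ?_
        rintro _ ⟨k, hk, rfl⟩
        exact hmax k hk
      have h2 : ∑ i, l i * g i xstar - μ t * D l ≤ phiMu m g Q D (μ t) xstar :=
        le_csSup (hbd _ _) ⟨l, hl, rfl⟩
      have h3 : ∑ i, l i * g i (x t) - ∑ i, l i * g i xstar
          ≤ ∑ i, l i * fderiv ℝ (g i) (x t) (x t - xstar) := by
        rw [← Finset.sum_sub_distrib]
        refine Finset.sum_le_sum fun i _ => ?_
        rw [← mul_sub]
        exact mul_le_mul_of_nonneg_left (convex_grad _ (hg i) (hgdiff i) _ _) (hQpos l hl i)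
      linarith
  have hμ'np : ∀ t ∈ Ioi t0, μ' t ≤ 0 := by
    intro t ht
    have h1 := hμanti.derivWithin_nonpos (x := t)
    rwa [derivWithin_of_mem_nhds (Ici_mem_nhds ht), (hμderiv t (Ioi_subset_Ici_self ht)).deriv] at h1
  set W : ℝ → ℝ := fun t => phiMu m g Q D (μ t) (x t) - phi m g Q xstar + C * μ t with hWdef
  have hWnn : ∀ t ∈ Ici t0, 0 ≤ W t := by
    intro t ht
    have := hle2 (x t) (μ t) (hμpos t ht)
    have := hstar (x t)
    simp only [hWdef]
    linarith
  choose! d hd0 hdC hdder hdsub using hpt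
  have hWder : ∀ t ∈ Ici t0, HasDerivAt W
      (inner ℝ (gradient (phiMu m g Q D (μ t)) (x t)) (x' t) - μ' t * d t + C * μ' t) t := by
    intro t ht
    exact ((hdder t ht).sub_const _).add ((hμderiv t ht).const_mul C)
  have hWcont : ContinuousOn W (Ici t0) :=
    fun t ht => (hWder t ht).continuousAt.continuousWithinAt
  have hvder : ∀ t ∈ Ici t0, HasDerivAt (fun t => (α - 1) • (x t - xstar) + t • x' t)
      (-(t • gradient (phiMu m g Q D (μ t)) (x t))) t := by
    intro t ht
    have htp : t ≠ 0 := (ht0.trans_le ht).ne'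
    have h := (((hx' t ht).sub_const xstar).const_smul (α - 1)).add
      ((hasDerivAt_id t).smul (hx'' t ht))
    refine h.congr_deriv ?_
    have ho := hODE t ht
    have hg' : gradient (phiMu m g Q D (μ t)) (x t) = -(x'' t) - (α / t) • x' t := by
      rw [eq_sub_iff_add_eq, eq_neg_iff_add_eq_zero, ← ho]; abel
    rw [hg', smul_sub, smul_smul, mul_div_cancel₀ _ htp]
    simp only [id]
    module
  have hWint : IntegrableOn (fun t => t * W t) (Ioi t0) := by
    refine final_step t0 α C ht0 hα
      (fun t => t ^ 2 * W t +
        (1/2) * ‖(α - 1) • (x t - xstar) + t • x' t‖ ^ 2)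
      (fun t => (2 * t * W t + t ^ 2 *
        (inner ℝ (gradient (phiMu m g Q D (μ t)) (x t)) (x' t) - μ' t * d t + C * μ' t)) +
        (1/2) * (2 * inner ℝ ((α - 1) • (x t - xstar) + t • x' t)
          (-(t • gradient (phiMu m g Q D (μ t)) (x t))))) W μ ?_ ?_ hWcont hWnn hC0
      (fun t ht => (hμpos t ht).le) hA1 ?_
    · intro t ht
      have h1 : HasDerivAt (fun t : ℝ => t ^ 2) (2 * t) t := by
        simpa using hasDerivAt_pow 2 t
      exact (h1.mul (hWder t ht)).add ((hvder t ht).norm_sq.const_mul (1/2))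
    · intro t ht
      have := hWnn t ht
      positivity
    · intro t ht
      have ht' : t ∈ Ici t0 := Ioi_subset_Ici_self ht
      have htp : 0 < t := ht0.trans ht
      have h1 := hdsub t ht'
      have h2 := hle1 xstar (μ t) (hμpos t ht')
      have h3 := hμ'np t ht
      have h4 := hdC t ht'
      have h5 : W t = phiMu m g Q D (μ t) (x t) - phi m g Q xstar + C * μ t := rfl
      rw [inner_neg_right, inner_smul_right, inner_add_left, inner_smul_left, inner_smul_left,
        real_inner_comm _ (x t - xstar), real_inner_comm _ (x' t)]
      simp only [conj_trivial]
      generalize inner ℝ (gradient (phiMu m g Q D (μ t)) (x t)) (x t - xstar) = A at *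
      generalize inner ℝ (gradient (phiMu m g Q D (μ t)) (x t)) (x' t) = B at *
      have h6 : t ^ 2 * (μ' t * (C - d t)) ≤ 0 :=
        mul_nonpos_of_nonneg_of_nonpos (by positivity)
          (mul_nonpos_of_nonpos_of_nonneg h3 (by linarith))
      have h7 : (α - 1) * t * (W t - C * μ t) ≤ (α - 1) * t * A :=
        mul_le_mul_of_nonneg_left (by linarith) (mul_nonneg (by linarith) htp.le)
      nlinarith
  have hmeas : AEStronglyMeasurable
      (fun t => t * |phiMu m g Q D (μ t) (x t) - phi m g Q xstar|)
      (volume.restrict (Ioi t0)) := by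
    refine ContinuousOn.aestronglyMeasurable (fun t ht => ?_) measurableSet_Ioi
    have h := (hdder t (Ioi_subset_Ici_self ht)).continuousAt
    exact (continuousAt_id.mul (h.sub continuousAt_const).abs).continuousWithinAt
  refine Integrable.mono' (hWint.add (hA1.const_mul C)) hmeas ?_
  filter_upwards [ae_restrict_mem measurableSet_Ioi] with t ht
  have htp : 0 < t := ht0.trans ht
  have hw := hWnn t (Ioi_subset_Ici_self ht)
  have hm := mul_nonneg hC0 (hμpos t (Ioi_subset_Ici_self ht)).le
  have h5 : W t = phiMu m g Q D (μ t) (x t) - phi m g Q xstar + C * μ t := rfl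
  rw [Real.norm_of_nonneg (by positivity)]
  have : |phiMu m g Q D (μ t) (x t) - phi m g Q xstar| ≤ W t + C * μ t := by
    rw [abs_le]; constructor <;> linarith
  have := mul_le_mul_of_nonneg_left this htp.le
  simp only [Pi.add_apply]
  linarith
end

section
/- Under Assumption A, the velocity decays at rate O(1/t): there exists a constant K > 0 such that ‖ẋ(t)‖ ≤ K/t for all t ≥ t0. -/
open scoped BigOperators
open Set Filter MeasureTheory

section helpers

variable {H : Type*} [NormedAddCommGroup H] [InnerProductSpace ℝ H]

lemma aux_lcont (m : ℕ) (a : Fin m → ℝ)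
    (D : EuclideanSpace ℝ (Fin m) → ℝ) (hDcont : Continuous D) (μ : ℝ) :
    Continuous (fun l : EuclideanSpace ℝ (Fin m) => ∑ i, l i * a i - μ * D l) := by
  refine Continuous.sub (continuous_finsetSum _ fun i _ => ?_) (continuous_const.mul hDcont)
  exact (by fun_prop : Continuous fun z : EuclideanSpace ℝ (Fin m) => z i).mul continuous_const

lemma aux_bdd (m : ℕ) (a : Fin m → ℝ) (Q : Set (EuclideanSpace ℝ (Fin m)))
    (hQcomp : IsCompact Q) (D : EuclideanSpace ℝ (Fin m) → ℝ) (hDcont : Continuous D) (μ : ℝ) :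
    BddAbove ((fun l : EuclideanSpace ℝ (Fin m) => ∑ i, l i * a i - μ * D l) '' Q) := by
  apply hQcomp.bddAbove_image
  exact (aux_lcont m a D hDcont μ).continuousOn

lemma aux_strong (m : ℕ) (a : Fin m → ℝ) (Q : Set (EuclideanSpace ℝ (Fin m)))
    (hQconv : Convex ℝ Q) (D : EuclideanSpace ℝ (Fin m) → ℝ)
    (σ : ℝ) (hDsc : StrongConvexOn Q σ D) (μ : ℝ) (hμ : 0 < μ)
    (p : EuclideanSpace ℝ (Fin m)) (hp : p ∈ Q)
    (hmax : ∀ l ∈ Q, ∑ i, l i * a i - μ * D l ≤ ∑ i, p i * a i - μ * D p)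
    (l : EuclideanSpace ℝ (Fin m)) (hl : l ∈ Q) :
    ∑ i, l i * a i - μ * D l ≤ ∑ i, p i * a i - μ * D p
      - μ * σ / 4 * ∑ i, (l i - p i) ^ 2 := by
  have h1 := hDsc.2 hl hp (show (0:ℝ) ≤ 1/2 by norm_num) (show (0:ℝ) ≤ 1/2 by norm_num) (by norm_num)
  have h2 := hmax _ (hQconv hl hp (a := 1/2) (b := 1/2) (by norm_num) (by norm_num) (by norm_num))
  have h3 : ‖l - p‖ ^ 2 = ∑ i, (l i - p i) ^ 2 := by
    rw [EuclideanSpace.norm_sq_eq]; simp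
  have h4 : ∑ i, (((1:ℝ)/2) • l + ((1:ℝ)/2) • p) i * a i
      = 1/2 * ∑ i, l i * a i + 1/2 * ∑ i, p i * a i := by
    rw [Finset.mul_sum, Finset.mul_sum, ← Finset.sum_add_distrib]
    refine Finset.sum_congr rfl fun i _ => ?_
    simp; ring
  rw [h4] at h2
  simp only [smul_eq_mul] at h1
  rw [h3] at h1
  nlinarith [mul_le_mul_of_nonneg_left h1 hμ.le]

lemma aux_danskin_s12 (m : ℕ) (g : Fin m → H → ℝ)
    (hgdiff : ∀ i, Differentiable ℝ (g i))
    (Q : Set (EuclideanSpace ℝ (Fin m))) (hQne : Q.Nonempty) (hQcomp : IsCompact Q)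
    (hQconv : Convex ℝ Q)
    (D : EuclideanSpace ℝ (Fin m) → ℝ) (hDcont : Continuous D)
    (σ : ℝ) (hσ : 0 < σ) (hDsc : StrongConvexOn Q σ D) (μ : ℝ) (hμ : 0 < μ) (x : H) :
    DifferentiableAt ℝ (phiMu m g Q D μ) x := by
  obtain ⟨p, hp, hmax⟩ := hQcomp.exists_isMaxOn hQne
    (f := fun l : EuclideanSpace ℝ (Fin m) => ∑ i, l i * g i x - μ * D l)
    (aux_lcont m (fun i => g i x) D hDcont μ).continuousOn
  have hmax' : ∀ l ∈ Q, ∑ i, l i * g i x - μ * D l ≤ ∑ i, p i * g i x - μ * D p :=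
    fun l hl => hmax hl
  have hc : 0 < μ * σ / 4 := by positivity
  set c := μ * σ / 4 with hcdef
  let k : H → ℝ := fun y => ∑ i, p i * g i y - μ * D p
  let q : H → ℝ := fun y => (1 / (4 * c)) * ∑ i, (g i y - g i x) ^ 2
  have hlow : ∀ y, k y ≤ phiMu m g Q D μ y := fun y =>
    le_csSup (aux_bdd m (fun i => g i y) Q hQcomp D hDcont μ) ⟨p, hp, rfl⟩
  have hup : ∀ y, phiMu m g Q D μ y ≤ k y + q y := by
    intro y
    apply csSup_le (hQne.image _)
    rintro _ ⟨l, hl, rfl⟩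
    have h1 := aux_strong m (fun i => g i x) Q hQconv D σ hDsc μ hμ p hp hmax' l hl
    rw [← hcdef] at h1
    have h2 : ∑ i, (l i - p i) * (g i y - g i x) ≤
        c * ∑ i, (l i - p i) ^ 2 + q y := by
      simp only [q]
      rw [Finset.mul_sum, Finset.mul_sum, ← Finset.sum_add_distrib]
      refine Finset.sum_le_sum fun i _ => ?_
      have : c * (l i - p i)^2 + 1 / (4 * c) * (g i y - g i x)^2 - (l i - p i) * (g i y - g i x)
          = c * ((l i - p i) - (g i y - g i x) / (2 * c)) ^ 2 := by
        field_simp; ring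
      have h0 : 0 ≤ c * ((l i - p i) - (g i y - g i x) / (2 * c)) ^ 2 := by positivity
      linarith
    have h3 : ∑ i, (l i - p i) * (g i y - g i x) = ∑ i, l i * g i y - ∑ i, l i * g i x
        - ∑ i, p i * g i y + ∑ i, p i * g i x := by
      rw [← Finset.sum_sub_distrib, ← Finset.sum_sub_distrib, ← Finset.sum_add_distrib]
      exact Finset.sum_congr rfl fun i _ => by ring
    simp only [k]
    linarith
  have hqx : q x = 0 := by simp [q]
  have hqd : HasFDerivAt q (0 : H →L[ℝ] ℝ) x := by
    have : HasFDerivAt q ((1 / (4 * c)) • ∑ i, ((2 * (g i x - g i x) ^ 1) • fderiv ℝ (g i) x)) x := by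
      refine HasFDerivAt.const_mul (HasFDerivAt.fun_sum fun i _ => ?_) _
      have := (((hgdiff i x).hasFDerivAt.sub_const (g i x)).pow 2)
      simpa using this
    simpa using this
  have hr : HasFDerivAt (fun y => phiMu m g Q D μ y - k y) (0 : H →L[ℝ] ℝ) x := by
    have hx0 : phiMu m g Q D μ x - k x = 0 := by
      have := hlow x; have := hup x; linarith
    rw [hasFDerivAt_iff_isLittleO] at hqd ⊢
    refine Asymptotics.IsBigO.trans_isLittleO ?_ hqd
    refine Asymptotics.IsBigO.of_bound 1 (Eventually.of_forall fun y => ?_)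
    have h1 := hlow y
    have h2 := hup y
    simp only [hx0, hqx, sub_zero, _root_.zero_apply, one_mul, Real.norm_eq_abs]
    rw [abs_of_nonneg (by linarith), abs_of_nonneg (by linarith)]
    linarith
  have hk : DifferentiableAt ℝ k x := by
    have : ∀ i, DifferentiableAt ℝ (g i) x := fun i => hgdiff i x
    fun_prop
  have := hr.differentiableAt.add hk
  refine this.congr_of_eventuallyEq (Eventually.of_forall fun y => ?_)
  simp

lemma aux_convex_s12 (m : ℕ) (g : Fin m → H → ℝ) (hg : ∀ i, ConvexOn ℝ Set.univ (g i))
    (Q : Set (EuclideanSpace ℝ (Fin m))) (hQne : Q.Nonempty) (hQcomp : IsCompact Q)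
    (hQpos : ∀ l ∈ Q, ∀ i, 0 ≤ l i)
    (D : EuclideanSpace ℝ (Fin m) → ℝ) (hDcont : Continuous D) (μ : ℝ) :
    ConvexOn ℝ Set.univ (phiMu m g Q D μ) := by
  refine ⟨convex_univ, fun x _ y _ a b ha hb hab => ?_⟩
  apply csSup_le (hQne.image _)
  rintro _ ⟨l, hl, rfl⟩
  have hx : ∑ i, l i * g i x - μ * D l ≤ phiMu m g Q D μ x :=
    le_csSup (aux_bdd m (fun i => g i x) Q hQcomp D hDcont μ) ⟨l, hl, rfl⟩
  have hy : ∑ i, l i * g i y - μ * D l ≤ phiMu m g Q D μ y :=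
    le_csSup (aux_bdd m (fun i => g i y) Q hQcomp D hDcont μ) ⟨l, hl, rfl⟩
  have h1 : ∑ i, l i * g i (a • x + b • y) ≤ a * ∑ i, l i * g i x + b * ∑ i, l i * g i y := by
    rw [Finset.mul_sum, Finset.mul_sum, ← Finset.sum_add_distrib]
    refine Finset.sum_le_sum fun i _ => ?_
    have := mul_le_mul_of_nonneg_left
      ((hg i).2 (mem_univ x) (mem_univ y) ha hb hab) (hQpos l hl i)
    simp only [smul_eq_mul] at this
    linarith
  simp only [smul_eq_mul]
  have h2 := mul_le_mul_of_nonneg_left hx ha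
  have h3 := mul_le_mul_of_nonneg_left hy hb
  have h4 : μ * D l = a * (μ * D l) + b * (μ * D l) := by rw [← add_mul, hab, one_mul]
  linarith

lemma aux_first_order (f : H → ℝ) (hf : ConvexOn ℝ Set.univ f) (x y : H) (f' : H →L[ℝ] ℝ)
    (h : HasFDerivAt f f' x) : f x - f y ≤ f' (x - y) := by
  have hl : HasDerivAt (fun s : ℝ => x + s • (y - x)) (y - x) 0 := by
    simpa using ((hasDerivAt_id (0:ℝ)).smul_const (y - x)).const_add x
  have hF : HasDerivAt (fun s : ℝ => f (x + s • (y - x))) (f' (y - x)) 0 := by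
    have h' : HasFDerivAt f f' (x + (0:ℝ) • (y - x)) := by simpa using h
    exact h'.comp_hasDerivAt (0:ℝ) hl
  have hs := hF.hasDerivWithinAt (s := Ioi 0)
  rw [hasDerivWithinAt_iff_tendsto_slope' (by simp)] at hs
  have : f' (y - x) ≤ f y - f x := by
    refine le_of_tendsto hs ?_
    have : Ioc (0:ℝ) 1 ∈ nhdsWithin 0 (Ioi 0) := Ioc_mem_nhdsGT (by norm_num)
    filter_upwards [this] with s hs
    have hc := hf.2 (mem_univ x) (mem_univ y)
      (show 0 ≤ 1 - s by linarith [hs.2]) hs.1.le (by ring)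
    have he : (1 - s) • x + s • y = x + s • (y - x) := by
      rw [sub_smul, smul_sub, one_smul]; abel
    rw [he] at hc
    simp only [smul_eq_mul] at hc
    rw [slope_def_field]
    simp only [zero_smul, add_zero, sub_zero]
    rw [div_le_iff₀ hs.1]
    linarith
  have h2 : f' (x - y) = - f' (y - x) := by rw [← map_neg, neg_sub]
  linarith

lemma aux_cont_s12 (m : ℕ) (g : Fin m → H → ℝ) (hgc : ∀ i, Continuous (g i))
    (Q : Set (EuclideanSpace ℝ (Fin m))) (hQcomp : IsCompact Q)
    (D : EuclideanSpace ℝ (Fin m) → ℝ) (hDcont : Continuous D) :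
    Continuous (fun ay : ℝ × H => phiMu m g Q D ay.1 ay.2) := by
  have h : Continuous (fun z : (ℝ × H) × EuclideanSpace ℝ (Fin m) =>
      ∑ i, z.2 i * g i z.1.2 - z.1.1 * D z.2) := by
    refine Continuous.sub (continuous_finsetSum _ fun i _ => ?_) ?_
    · have := (hgc i).comp (continuous_snd.comp
        (continuous_fst (X := ℝ × H) (Y := EuclideanSpace ℝ (Fin m))))
      exact (by fun_prop : Continuous fun z : (ℝ × H) × EuclideanSpace ℝ (Fin m) => z.2 i).mul this
    · fun_prop
  let F : (ℝ × H) → EuclideanSpace ℝ (Fin m) → ℝ := fun ay l =>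
    ∑ i, l i * g i ay.2 - ay.1 * D l
  have h' : Continuous (Function.uncurry F) := h
  have h2 := IsCompact.continuous_sSup (f := F) hQcomp h'
  have h3 : (fun ay : ℝ × H => phiMu m g Q D ay.1 ay.2) = fun ay => sSup (F ay '' Q) := by
    funext ay
    rfl
  rw [h3]
  exact h2

end helpers

set_option maxHeartbeats 2000000

theorem statement12 {H : Type*} [NormedAddCommGroup H] [InnerProductSpace ℝ H]
    [CompleteSpace H]
    (m : ℕ) (hm : 1 ≤ m)
    (g : Fin m → H → ℝ) (hg : ∀ i, ConvexOn ℝ Set.univ (g i))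
    (hgdiff : ∀ i, Differentiable ℝ (g i))
    -- each `∇ g i` is Lipschitz continuous on every bounded set
    (hgradLip : ∀ i, ∀ s : Set H, Bornology.IsBounded s →
      ∃ Li : ℝ, ∀ x ∈ s, ∀ y ∈ s,
        ‖gradient (g i) x - gradient (g i) y‖ ≤ Li * ‖x - y‖)
    (Q : Set (EuclideanSpace ℝ (Fin m))) (hQne : Q.Nonempty) (hQcomp : IsCompact Q)
    (hQconv : Convex ℝ Q) (hQpos : ∀ l ∈ Q, ∀ i, 0 ≤ l i)
    (D : EuclideanSpace ℝ (Fin m) → ℝ) (hDcont : Continuous D)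
    (hDnonneg : ∀ l ∈ Q, 0 ≤ D l)
    (σ : ℝ) (hσ : 0 < σ) (hDsc : StrongConvexOn Q σ D)
    (hDinf : IsGLB (D '' Q) 0)
    (C : ℝ) (hC : IsLUB (D '' Q) C)
    -- `D` is differentiable on a neighborhood `U` of `Q`
    (U : Set (EuclideanSpace ℝ (Fin m))) (hUopen : IsOpen U) (hQU : Q ⊆ U)
    (hDdiff : ∀ l ∈ U, DifferentiableAt ℝ D l)
    -- `xstar` is a minimizer of `φ` (so `inf φ = φ xstar`)
    (xstar : H) (hstar : ∀ y : H, phi m g Q xstar ≤ phi m g Q y)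
    -- time data
    (t0 α : ℝ) (ht0 : 0 < t0) (hα : 3 ≤ α)
    -- `μ` is continuously differentiable, positive and nonincreasing on `[t0, ∞)`
    (μ μ' : ℝ → ℝ) (hμpos : ∀ t ∈ Set.Ici t0, 0 < μ t)
    (hμderiv : ∀ t ∈ Set.Ici t0, HasDerivAt μ (μ' t) t)
    (hμ'cont : ContinuousOn μ' (Set.Ici t0))
    (hμanti : AntitoneOn μ (Set.Ici t0))
    -- `x` is a twice continuously differentiable solution of the inertial system
    (x x' x'' : ℝ → H)
    (hx' : ∀ t ∈ Set.Ici t0, HasDerivAt x (x' t) t)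
    (hx'' : ∀ t ∈ Set.Ici t0, HasDerivAt x' (x'' t) t)
    (hx''cont : ContinuousOn x'' (Set.Ici t0))
    (hODE : ∀ t ∈ Set.Ici t0,
      x'' t + (α / t) • x' t + gradient (phiMu m g Q D (μ t)) (x t) = 0)
    -- Assumption A
    (hA1 : MeasureTheory.IntegrableOn (fun t => t * μ t) (Set.Ioi t0))
    (hA2 : MeasureTheory.IntegrableOn (fun t => t ^ 2 * |μ' t|) (Set.Ioi t0))
 :
    ∃ K : ℝ, 0 < K ∧ ∀ t ∈ Set.Ici t0, ‖x' t‖ ≤ K / t := by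
  classical
  set P := phiMu m g Q D with hP
  set ps := phi m g Q xstar with hps
  have hDC : ∀ l ∈ Q, D l ≤ C := fun l hl => hC.1 ⟨l, hl, rfl⟩
  have hC0 : 0 ≤ C := by
    obtain ⟨l, hl⟩ := hQne
    exact (hDnonneg l hl).trans (hDC l hl)
  have hbd := fun (a : Fin m → ℝ) (r : ℝ) => aux_bdd m a Q hQcomp D hDcont r
  have hbd0 : ∀ a : Fin m → ℝ,
      BddAbove ((fun l : EuclideanSpace ℝ (Fin m) => ∑ i, l i * a i) '' Q) := by
    intro a
    have := hbd a 0
    simpa using this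
  -- lower bound
  have hlow : ∀ r, 0 < r → ∀ y, ps ≤ P r y + r * C := by
    intro r hr y
    refine (hstar y).trans ?_
    apply csSup_le (hQne.image _)
    rintro _ ⟨l, hl, rfl⟩
    have h1 : ∑ i, l i * g i y - r * D l ≤ P r y := le_csSup (hbd (fun i => g i y) r) ⟨l, hl, rfl⟩
    have h2 := mul_le_mul_of_nonneg_left (hDC l hl) hr.le
    simp only
    linarith
  have hupp : ∀ r, 0 < r → P r xstar ≤ ps := by
    intro r hr
    apply csSup_le (hQne.image _)
    rintro _ ⟨l, hl, rfl⟩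
    have h1 : ∑ i, l i * g i xstar ≤ ps := le_csSup (hbd0 (fun i => g i xstar)) ⟨l, hl, rfl⟩
    have h2 := mul_nonneg hr.le (hDnonneg l hl)
    simp only
    linarith
  have hmono : ∀ r s, r ≤ s → ∀ y, P r y + r * C ≤ P s y + s * C := by
    intro r s hrs y
    have : P r y ≤ P s y + s * C - r * C := by
      apply csSup_le (hQne.image _)
      rintro _ ⟨l, hl, rfl⟩
      have h1 : ∑ i, l i * g i y - s * D l ≤ P s y :=
        le_csSup (hbd (fun i => g i y) s) ⟨l, hl, rfl⟩
      have h2 := mul_le_mul_of_nonneg_left (hDC l hl) (sub_nonneg.2 hrs)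
      simp only
      linarith
    linarith
  have hxcont : ContinuousOn x (Ici t0) := fun t ht => (hx' t ht).continuousAt.continuousWithinAt
  have hx'cont : ContinuousOn x' (Ici t0) := fun t ht => (hx'' t ht).continuousAt.continuousWithinAt
  have hμcont : ContinuousOn μ (Ici t0) :=
    fun t ht => (hμderiv t ht).continuousAt.continuousWithinAt
  have hPcont : ContinuousOn (fun t => P (μ t) (x t)) (Ici t0) := by
    have hc : Continuous (fun ay : ℝ × H => P ay.1 ay.2) :=
      aux_cont_s12 m g (fun i => (hgdiff i).continuous) Q hQcomp D hDcont
    have hpair : ContinuousOn (fun t => (μ t, x t)) (Ici t0) := hμcont.prodMk hxcont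
    exact Continuous.comp_continuousOn (g := fun ay : ℝ × H => P ay.1 ay.2)
      (f := fun t => (μ t, x t)) hc hpair
  -- Lyapunov function
  let v : ℝ → H := fun t => (2:ℝ) • (x t - xstar) + t • x' t
  let V : ℝ → ℝ := fun t => 1 / 2 * ‖v t‖ ^ 2 + (α - 3) * ‖x t - xstar‖ ^ 2
  let E : ℝ → ℝ := fun t => t ^ 2 * (P (μ t) (x t) + μ t * C - ps) + V t
  have hv : ∀ t ∈ Ici t0, HasDerivAt v ((2:ℝ) • x' t + (t • x'' t + x' t)) t := by
    intro t ht
    have h2 := (hasDerivAt_id t).smul (hx'' t ht)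
    simp only [id, one_smul] at h2
    exact (((hx' t ht).sub_const xstar).const_smul (2:ℝ)).add h2
  have hV : ∀ t ∈ Ici t0, HasDerivAt V (1 / 2 * (2 * inner ℝ (v t)
      ((2:ℝ) • x' t + (t • x'' t + x' t))) + (α - 3) * (2 * inner ℝ (x t - xstar) (x' t))) t := by
    intro t ht
    exact ((hv t ht).norm_sq.const_mul _).add
      ((((hx' t ht).sub_const xstar).norm_sq).const_mul _)
  have hEcont : ContinuousOn E (Ici t0) := by
    have hVc : ContinuousOn V (Ici t0) :=
      fun t ht => (hV t ht).continuousAt.continuousWithinAt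
    exact (((continuous_pow 2).continuousOn).mul
      ((hPcont.add (hμcont.mul continuousOn_const)).sub continuousOn_const)).add hVc
  let w : ℝ → ℝ := fun s => 2 * C * (s * μ s)
  have hwint : IntegrableOn w (Ioi t0) := hA1.const_mul (2 * C)
  have hwcont : ContinuousOn w (Ici t0) := by fun_prop
  have hwnn : ∀ t ∈ Ici t0, 0 ≤ w t := by
    intro t ht
    have : 0 < t := lt_of_lt_of_le ht0 ht
    have := hμpos t ht
    positivity
  let M0 : ℝ := ∫ s in Ioi t0, w s
  have hE : ∀ t ∈ Ici t0, E t ≤ E t0 + M0 := by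
    intro T hT
    let B : ℝ → ℝ := fun t => E t0 + ∫ s in t0..t, w s
    have hii : ∀ t ∈ Ici t0, IntervalIntegrable w volume t0 t := by
      intro t ht
      apply ContinuousOn.intervalIntegrable
      rw [uIcc_of_le ht]
      exact hwcont.mono Icc_subset_Ici_self
    have hBd : ∀ t ∈ Ici t0, HasDerivWithinAt B (w t) (Ici t) t := by
      intro t ht
      refine HasDerivWithinAt.const_add _ ?_
      refine intervalIntegral.integral_hasDerivWithinAt_right (hii t ht) (t := Ioi t) ?_ ?_
      · exact ⟨Ioi t, self_mem_nhdsWithin,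
          (hwcont.mono (fun s hs => mem_Ici.2 (le_trans (mem_Ici.1 ht) (le_of_lt (mem_Ioi.1 hs))))).aestronglyMeasurable
            measurableSet_Ioi⟩
      · exact (hwcont t ht).mono
          (fun s hs => mem_Ici.2 (le_trans (mem_Ici.1 ht) (le_of_lt (mem_Ioi.1 hs))))
    have key : E T ≤ B T := by
      refine image_le_of_liminf_slope_right_le_deriv_boundary (a := t0) (b := T)
        (f := E) (B := B) (B' := w)
        (hEcont.mono Icc_subset_Ici_self) (by simp [B]) ?_ ?_ ?_ ⟨hT, le_rfl⟩
      · have : ContinuousOn (fun t => ∫ s in t0..t, w s) (uIcc t0 T) :=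
          intervalIntegral.continuousOn_primitive_interval
            ((intervalIntegrable_iff_integrableOn_Icc_of_le hT).1 (hii T hT) |> fun h => by
              rwa [uIcc_of_le hT])
        rw [uIcc_of_le hT] at this
        exact continuousOn_const.add this
      · intro t ht
        exact hBd t ht.1
      · intro t ht r hr
        have htI : t ∈ Ici t0 := ht.1
        have htp : 0 < t := lt_of_lt_of_le ht0 htI
        have hμt := hμpos t htI
        have hd : DifferentiableAt ℝ (P (μ t)) (x t) :=
          aux_danskin_s12 m g hgdiff Q hQne hQcomp hQconv D hDcont σ hσ hDsc (μ t) hμt (x t)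
        have hgr := hd.hasGradientAt
        set G := gradient (P (μ t)) (x t) with hG
        have hcv := aux_first_order (P (μ t))
          (aux_convex_s12 m g hg Q hQne hQcomp hQpos D hDcont (μ t)) (x t) xstar _
          hgr.hasFDerivAt
        rw [InnerProductSpace.toDual_apply_apply] at hcv
        have hcomp : HasDerivAt (fun z => P (μ t) (x z)) (inner ℝ G (x' t)) t := by
          have := hgr.hasFDerivAt.comp_hasDerivAt t (hx' t htI)
          rw [InnerProductSpace.toDual_apply_apply] at this
          exact this
        let h : ℝ → ℝ := fun z => z ^ 2 * (P (μ t) (x z) + μ t * C - ps) + V z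
        have hh : HasDerivAt h (2 * t * (P (μ t) (x t) + μ t * C - ps) + t ^ 2 * inner ℝ G (x' t) +
          (1 / 2 * (2 * inner ℝ (v t)
      ((2:ℝ) • x' t + (t • x'' t + x' t))) + (α - 3) * (2 * inner ℝ (x t - xstar) (x' t)))) t := by
          refine HasDerivAt.add ?_ (hV t htI)
          have h1 := (hasDerivAt_pow 2 t).mul ((hcomp.add_const (μ t * C)).sub_const ps)
          refine h1.congr_deriv ?_
          norm_num
        have hvd : (2:ℝ) • x' t + (t • x'' t + x' t) = (3 - α) • x' t - t • G := by
          have h0 := hODE t htI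
          have h1 : x'' t = - ((α / t) • x' t) - G := by
            rw [eq_sub_iff_add_eq, eq_neg_iff_add_eq_zero, ← h0]; abel
          rw [h1, smul_sub, smul_neg, smul_smul, mul_div_cancel₀ _ htp.ne']
          module
        have hle : 2 * t * (P (μ t) (x t) + μ t * C - ps) + t ^ 2 * inner ℝ G (x' t) +
          (1 / 2 * (2 * inner ℝ (v t)
      ((2:ℝ) • x' t + (t • x'' t + x' t))) + (α - 3) * (2 * inner ℝ (x t - xstar) (x' t)))
            ≤ w t := by
          rw [hvd]
          simp only [v, w, inner_add_left, inner_sub_right, inner_smul_left, inner_smul_right,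
            RCLike.conj_to_real, real_inner_self_eq_norm_sq]
          rw [real_inner_comm G (x' t)]
          have hcv' : P (μ t) (x t) - ps ≤ inner ℝ G (x t) - inner ℝ G xstar := by
            rw [← inner_sub_right]
            linarith [hupp (μ t) hμt]
          have e1 : inner ℝ (x t - xstar) G = inner ℝ G (x t) - inner ℝ G xstar := by
            rw [real_inner_comm, inner_sub_right]
          rw [e1]
          have h5 := mul_le_mul_of_nonneg_left hcv' htp.le
          have h6 : 0 ≤ (α - 3) * (t * ‖x' t‖ ^ 2) :=
            mul_nonneg (by linarith) (by positivity)
          nlinarith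
        have hs := (hh.hasDerivWithinAt (s := Ioi t))
        rw [hasDerivWithinAt_iff_tendsto_slope' (by simp)] at hs
        have hev := hs.eventually_lt_const (lt_of_le_of_lt hle hr)
        apply Eventually.frequently
        filter_upwards [hev, self_mem_nhdsWithin] with z hz hzt
        refine lt_of_le_of_lt ?_ hz
        have hzt' : t < z := hzt
        rw [slope_def_field, slope_def_field]
        apply div_le_div_of_nonneg_right _ (sub_pos.2 hzt').le
        have hzz : z ∈ Ici t0 := le_trans htI hzt'.le
        have := hmono _ _ (hμanti htI hzz hzt'.le) (x z)
        have h7 : E z ≤ h z := by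
          simp only [E, h]
          have := mul_le_mul_of_nonneg_left this (sq_nonneg z)
          nlinarith
        have h8 : E t = h t := rfl
        linarith
    refine key.trans ?_
    simp only [B]
    gcongr
    rw [intervalIntegral.integral_of_le hT]
    apply setIntegral_mono_set hwint
    · exact (ae_restrict_iff' measurableSet_Ioi).2
        (Eventually.of_forall fun s hs => hwnn s (mem_Ici.2 (le_of_lt (mem_Ioi.1 hs))))
    · exact (Ioc_subset_Ioi_self).eventuallyLE
  -- bound on v
  let M : ℝ := Real.sqrt (2 * |E t0 + M0|)
  have hM0 : 0 ≤ M := Real.sqrt_nonneg _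
  have hvM : ∀ t ∈ Ici t0, ‖v t‖ ≤ M := by
    intro t ht
    apply Real.le_sqrt_of_sq_le
    have h1 := hE t ht
    have h2 : 0 ≤ t ^ 2 * (P (μ t) (x t) + μ t * C - ps) :=
      mul_nonneg (sq_nonneg t) (by linarith [hlow (μ t) (hμpos t ht) (x t)])
    have h3 : 0 ≤ (α - 3) * ‖x t - xstar‖ ^ 2 := mul_nonneg (by linarith) (by positivity)
    have h4 := le_abs_self (E t0 + M0)
    simp only [E, V] at h1 h4 ⊢
    linarith
  let R : ℝ := ‖x t0 - xstar‖ + M / 2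
  have hxR : ∀ t ∈ Ici t0, ‖x t - xstar‖ ≤ R := by
    intro T hT
    have hTp : 0 < T := lt_of_lt_of_le ht0 hT
    have hfd : ∀ t ∈ Ici t0, HasDerivAt (fun t => t ^ 2 • (x t - xstar)) (t • v t) t := by
      intro t ht
      have := (hasDerivAt_pow 2 t).smul ((hx' t ht).sub_const xstar)
      refine this.congr_deriv ?_
      simp only [v]
      norm_num
      module
    have := image_norm_le_of_norm_deriv_right_le_deriv_boundary
      (f := fun t => t ^ 2 • (x t - xstar)) (f' := fun t => t • v t) (a := t0) (b := T)
      (B := fun t => t ^ 2 * R) (B' := fun t => 2 * t * R)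
      (fun t ht => (hfd t ht.1).continuousAt.continuousWithinAt)
      (fun t ht => (hfd t ht.1).hasDerivWithinAt)
      (by
        simp only [norm_smul, norm_pow, Real.norm_eq_abs, sq_abs, R]
        gcongr
        linarith)
      (fun t => by simpa using (hasDerivAt_pow 2 t).mul_const R)
      (fun t ht => by
        have htp : 0 < t := lt_of_lt_of_le ht0 ht.1
        rw [norm_smul, Real.norm_eq_abs, abs_of_pos htp]
        have := mul_le_mul_of_nonneg_left (hvM t ht.1) htp.le
        have h2 : 0 ≤ t * ‖x t0 - xstar‖ := by positivity
        simp only [R]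
        nlinarith) ⟨hT, le_rfl⟩
    simp only [norm_smul, norm_pow, Real.norm_eq_abs, sq_abs] at this
    exact le_of_mul_le_mul_left this (by positivity)
  refine ⟨M + 2 * R + 1, ?_, ?_⟩
  · have : 0 ≤ R := by positivity
    linarith
  · intro t ht
    have htp : 0 < t := lt_of_lt_of_le ht0 ht
    rw [le_div_iff₀ htp]
    have h1 : t • x' t = v t - (2:ℝ) • (x t - xstar) := by simp [v]
    have h2 : ‖t • x' t‖ ≤ ‖v t‖ + ‖(2:ℝ) • (x t - xstar)‖ := by rw [h1]; exact norm_sub_le _ _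
    rw [norm_smul, norm_smul, Real.norm_eq_abs, abs_of_pos htp] at h2
    have h3 := hvM t ht
    have h4 := hxR t ht
    norm_num at h2
    linarith
end
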